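/- Let 1 ≤ r ≤ n and let p be a size vector of length n with p_i > 2 for all i ∈ [n]. If (A, B) is a maximal pair of r-cross-intersecting families in S_p such that the set of coordinates relevant for A or for B has at most r + 3 elements, then A and B are balls. -/

import Mathlib

open Finset

/-- Families `A`, `B` of vectors in `S_p` (modelled as `∀ i, Fin (p i)`) are
`r`-cross-intersecting: every `x ∈ A` and `y ∈ B` agree in at least `r`
coordinates. -/
def CrossInt {n : ℕ} {p : Fin n → ℕ} (r : ℕ)
    (A B : Finset (∀ i, Fin (p i))) : Prop :=
  ∀ x ∈ A, ∀ y ∈ B, r ≤ (univ.filter (fun i => x i = y i)).card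

/-- `(A, B)` is a maximal `r`-cross-intersecting pair. -/
def MaxPair {n : ℕ} {p : Fin n → ℕ} (r : ℕ)
    (A B : Finset (∀ i, Fin (p i))) : Prop :=
  CrossInt r A B ∧ ∀ A' B' : Finset (∀ i, Fin (p i)),
    CrossInt r A' B' → A'.card * B'.card ≤ A.card * B.card

/-- Coordinate `i` is relevant for `A`: some two vectors differing only in
coordinate `i` are such that one belongs to `A` and the other one does not. -/
def Relevant {n : ℕ} {p : Fin n → ℕ} (A : Finset (∀ i, Fin (p i)))
    (i : Fin n) : Prop :=
  ∃ x y : ∀ j, Fin (p j), (∀ j, j ≠ i → x j = y j) ∧ x ∈ A ∧ y ∉ A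

/-- The Hamming ball of radius `k` around `x₀` in the coordinates `T`. -/
def hBall {n : ℕ} {p : Fin n → ℕ} (T : Finset (Fin n))
    (x₀ : ∀ i, Fin (p i)) (k : ℕ) : Finset (∀ i, Fin (p i)) :=
  univ.filter (fun x => (T.filter (fun i => x i ≠ x₀ i)).card ≤ k)

/-- `A` is a ball: a Hamming ball of some radius around some vector in some
set of coordinates. -/
def IsBall {n : ℕ} {p : Fin n → ℕ} (A : Finset (∀ i, Fin (p i))) : Prop :=
  ∃ (T : Finset (Fin n)) (x₀ : ∀ i, Fin (p i)) (k : ℕ), A = hBall T x₀ k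


section core
set_option linter.unusedSectionVars false
variable {ι : Type*} [DecidableEq ι]

/-- Weight of a set family. -/
def fwt (q : ι → ℝ) (F : Finset (Finset ι)) : ℝ := ∑ X ∈ F, ∏ i ∈ X, q i

/-- A dual pair of down-sets on `T` with unions of size at most `t`, of maximal weight. -/
structure Cfg (q : ι → ℝ) (T : Finset ι) (t : ℕ) (F G : Finset (Finset ι)) : Prop where
  hq : ∀ i ∈ T, 2 ≤ q i
  hT : t < T.card
  subF : ∀ X ∈ F, X ⊆ T
  subG : ∀ X ∈ G, X ⊆ T
  downF : ∀ X ∈ F, ∀ Y, Y ⊆ X → Y ∈ F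
  downG : ∀ X ∈ G, ∀ Y, Y ⊆ X → Y ∈ G
  emF : ∅ ∈ F
  emG : ∅ ∈ G
  cross : ∀ X ∈ F, ∀ Y ∈ G, (X ∪ Y).card ≤ t
  dualF : ∀ X, X ⊆ T → (∀ Y ∈ G, (X ∪ Y).card ≤ t) → X ∈ F
  dualG : ∀ Y, Y ⊆ T → (∀ X ∈ F, (X ∪ Y).card ≤ t) → Y ∈ G
  relF : ∀ a ∈ T, ∃ X ∈ F, insert a X ∉ F
  relG : ∀ a ∈ T, ∃ X ∈ G, insert a X ∉ G
  mx : ∀ H : Finset (Finset ι), (∀ X ∈ H, X ⊆ T) → (∀ X ∈ H, ∀ Y ∈ H, (X ∪ Y).card ≤ t) →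
    fwt q H ^ 2 ≤ fwt q F * fwt q G

theorem Cfg.symm {q : ι → ℝ} {T : Finset ι} {t : ℕ} {F G : Finset (Finset ι)}
    (h : Cfg q T t F G) : Cfg q T t G F where
  hq := h.hq
  hT := h.hT
  subF := h.subG
  subG := h.subF
  downF := h.downG
  downG := h.downF
  emF := h.emG
  emG := h.emF
  cross := fun X hX Y hY => by rw [union_comm]; exact h.cross Y hY X hX
  dualF := fun X hX hc => h.dualG X hX (fun Y hY => by rw [union_comm]; exact hc Y hY)
  dualG := fun X hX hc => h.dualF X hX (fun Y hY => by rw [union_comm]; exact hc Y hY)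
  relF := h.relG
  relG := h.relF
  mx := fun H h1 h2 => by rw [mul_comm]; exact h.mx H h1 h2

theorem fwt_mono {q : ι → ℝ} {T : Finset ι} (hq : ∀ i ∈ T, 2 ≤ q i)
    {F H : Finset (Finset ι)} (hFH : F ⊆ H) (hH : ∀ X ∈ H, X ⊆ T) : fwt q F ≤ fwt q H := by
  apply sum_le_sum_of_subset_of_nonneg hFH
  intro X hX _
  exact prod_nonneg (fun i hi => by have := hq i (hH X hX hi); linarith)

theorem fwt_nonneg {q : ι → ℝ} {T : Finset ι} (hq : ∀ i ∈ T, 2 ≤ q i)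
    {H : Finset (Finset ι)} (hH : ∀ X ∈ H, X ⊆ T) : 0 ≤ fwt q H := by
  apply sum_nonneg
  intro X hX
  exact prod_nonneg (fun i hi => by have := hq i (hH X hX hi); linarith)

theorem fwt_insert_le {q : ι → ℝ} {T : Finset ι} (hq : ∀ i ∈ T, 2 ≤ q i)
    {H : Finset (Finset ι)} (Y : Finset ι) (hY : Y ⊆ T) :
    fwt q (insert Y H) ≤ fwt q H + ∏ i ∈ Y, q i := by
  have h0 : 0 ≤ ∏ i ∈ Y, q i :=
    prod_nonneg (fun i hi => by have := hq i (hY hi); linarith)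
  by_cases h : Y ∈ H
  · rw [insert_eq_of_mem h]; linarith
  · unfold fwt; rw [sum_insert h]; linarith

theorem fwt_powerset (q : ι → ℝ) (Z : Finset ι) : fwt q Z.powerset = ∏ i ∈ Z, (1 + q i) := by
  unfold fwt
  rw [prod_one_add]

/-- subsets of size at most `k` -/
def lev (R : Finset ι) (k : ℕ) : Finset (Finset ι) := R.powerset.filter (fun X => X.card ≤ k)

theorem mem_lev {R X : Finset ι} {k : ℕ} : X ∈ lev R k ↔ X ⊆ R ∧ X.card ≤ k := by
  simp [lev]

theorem fwt_lev_zero (q : ι → ℝ) (R : Finset ι) : fwt q (lev R 0) = 1 := by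
  have : lev R 0 = {∅} := by
    ext X; rw [mem_lev]; simp; intro h; subst h; simp
  rw [this]; simp [fwt]

theorem lev_succ (R : Finset ι) (k : ℕ) : lev R (k+1) = lev R k ∪ R.powersetCard (k+1) := by
  ext X; simp only [mem_lev, mem_union, mem_powersetCard]
  constructor
  · rintro ⟨h1, h2⟩
    rcases Nat.lt_or_ge k X.card with h | h
    · right; exact ⟨h1, by omega⟩
    · left; exact ⟨h1, h⟩
  · rintro (⟨h1, h2⟩ | ⟨h1, h2⟩)
    · exact ⟨h1, by omega⟩
    · exact ⟨h1, by omega⟩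

theorem fwt_lev_succ (q : ι → ℝ) (R : Finset ι) (k : ℕ) :
    fwt q (lev R (k+1)) = fwt q (lev R k) + fwt q (R.powersetCard (k+1)) := by
  unfold fwt
  rw [lev_succ, sum_union]
  rw [disjoint_left]
  intro X h1 h2
  rw [mem_lev] at h1; rw [mem_powersetCard] at h2; omega

theorem fwt_lev_one (q : ι → ℝ) (R : Finset ι) : fwt q (lev R 1) = 1 + ∑ i ∈ R, q i := by
  rw [show (1:ℕ) = 0 + 1 from rfl, fwt_lev_succ, fwt_lev_zero]
  congr 1
  simp [fwt, powersetCard_one]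

theorem fwt_two_le (q : ι → ℝ) (R : Finset ι) :
    (∀ i ∈ R, 0 ≤ q i) → fwt q (R.powersetCard 2) ≤ (∑ i ∈ R, q i)^2/2 := by
  induction R using Finset.induction_on with
  | empty =>
    intro _
    rw [powersetCard_eq_empty.2 (by simp)]; simp [fwt]
  | insert a R ha ih =>
    intro hR
    have h1 := ih (fun i hi => hR i (mem_insert_of_mem hi))
    have h2 : fwt q ((insert a R).powersetCard 2) = fwt q (R.powersetCard 2) + q a * ∑ i ∈ R, q i := by
      unfold fwt
      rw [powersetCard_succ_insert ha, sum_union]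
      · congr 1
        rw [sum_image]
        · rw [powersetCard_one, sum_map, mul_sum]
          apply sum_congr rfl
          intro i hi
          simp only [Function.Embedding.coeFn_mk]
          rw [prod_insert, prod_singleton]
          simp; rintro rfl; exact ha hi
        · intro X hX Y hY hXY
          rw [mem_coe, mem_powersetCard] at hX hY
          have hX' : a ∉ X := fun h => ha (hX.1 h)
          have hY' : a ∉ Y := fun h => ha (hY.1 h)
          rw [← erase_insert hX', hXY, erase_insert hY']
      · rw [disjoint_left]
        intro X h1 h2
        rw [mem_powersetCard] at h1
        rw [mem_image] at h2
        obtain ⟨Y, _, rfl⟩ := h2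
        exact ha (h1.1 (mem_insert_self _ _))
    rw [h2, sum_insert ha]
    have := hR a (mem_insert_self _ _)
    nlinarith [sq_nonneg (q a)]

theorem fwt_lev_two_le (q : ι → ℝ) (R : Finset ι) (hR : ∀ i ∈ R, 0 ≤ q i) :
    fwt q (lev R 2) ≤ 1 + (∑ i ∈ R, q i) + (∑ i ∈ R, q i)^2/2 := by
  rw [show (2:ℕ) = 1 + 1 from rfl, fwt_lev_succ, fwt_lev_one]
  have := fwt_two_le q R hR
  linarith

/-- section of a family -/
def sect (F : Finset (Finset ι)) (R Y : Finset ι) : Finset (Finset ι) :=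
  R.powerset.filter (fun X => X ∪ Y ∈ F)

theorem mem_sect {F : Finset (Finset ι)} {R Y X : Finset ι} :
    X ∈ sect F R Y ↔ X ⊆ R ∧ X ∪ Y ∈ F := by simp [sect]

theorem fwt_sect (q : ι → ℝ) {T U : Finset ι} {F : Finset (Finset ι)}
    (hF : ∀ X ∈ F, X ⊆ T) :
    fwt q F = ∑ Y ∈ U.powerset, (∏ i ∈ Y, q i) * fwt q (sect F (T \ U) Y) := by
  unfold fwt
  simp_rw [mul_sum]
  rw [sum_sigma']
  refine sum_bij' (fun X _ => (⟨X ∩ U, X \ U⟩ : (_ : Finset ι) × Finset ι))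
    (fun P _ => P.2 ∪ P.1) ?_ ?_ ?_ ?_ ?_
  · intro X hX
    simp only [mem_sigma, mem_powerset, mem_sect]
    refine ⟨inter_subset_right, sdiff_subset_sdiff (hF X hX) (Subset.refl _), ?_⟩
    rw [sdiff_union_inter]; exact hX
  · rintro ⟨Y, X⟩ h
    simp only [mem_sigma, mem_powerset, mem_sect] at h
    exact h.2.2
  · intro X hX
    exact sdiff_union_inter _ _
  · rintro ⟨Y, X⟩ h
    simp only [mem_sigma, mem_powerset, mem_sect] at h
    obtain ⟨h1, h2, _⟩ := h
    have h3 : Disjoint X U := disjoint_of_subset_left h2 sdiff_disjoint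
    have e1 : (X ∪ Y) ∩ U = Y := by
      rw [union_inter_distrib_right, disjoint_iff_inter_eq_empty.1 h3, empty_union,
        inter_eq_left.2 h1]
    have e2 : (X ∪ Y) \ U = X := by
      rw [union_sdiff_distrib, sdiff_eq_self_of_disjoint h3, sdiff_eq_empty_iff_subset.2 h1,
        union_empty]
    simp only [e1, e2]
  · intro X hX
    simp only
    rw [mul_comm, ← prod_union, sdiff_union_inter]
    exact disjoint_of_subset_right inter_subset_right sdiff_disjoint

/-- bound for a level -/
noncomputable def lvb (k : ℕ) (s : ℝ) : ℝ := match k with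
  | 0 => 1
  | 1 => 1 + s
  | _ => 1 + s + s^2/2

theorem sect_le {q : ι → ℝ} {T U Y : Finset ι} (hq : ∀ i ∈ T, 2 ≤ q i)
    {F : Finset (Finset ι)} (k : ℕ) (hk : k ≤ 2)
    (h : ∀ X ⊆ T \ U, X ∪ Y ∈ F → X.card ≤ k) :
    fwt q (sect F (T \ U) Y) ≤ lvb k (∑ i ∈ T \ U, q i) := by
  have hq' : ∀ i ∈ T \ U, 2 ≤ q i := fun i hi => hq i (mem_sdiff.1 hi).1
  have h1 : fwt q (sect F (T \ U) Y) ≤ fwt q (lev (T \ U) k) := by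
    apply fwt_mono hq'
    · intro X hX
      rw [mem_sect] at hX
      rw [mem_lev]
      exact ⟨hX.1, h X hX.1 hX.2⟩
    · intro X hX
      rw [mem_lev] at hX
      exact hX.1
  refine h1.trans ?_
  interval_cases k
  · rw [fwt_lev_zero]; exact le_rfl
  · rw [fwt_lev_one]; exact le_rfl
  · exact fwt_lev_two_le q _ (fun i hi => by have := hq' i hi; linarith)

/-- section bound coming from a set `Z ⊆ U` in the other family -/
theorem Cfg.sect_bd {q : ι → ℝ} {T : Finset ι} {t : ℕ} {F G : Finset (Finset ι)}
    (h : Cfg q T t F G) {U Y Z : Finset ι} (hZ : Z ∈ G) (hZU : Z ⊆ U) (hY : Y ⊆ U)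
    (k : ℕ) (hk : k ≤ 2) (hc : t ≤ k + (Y ∪ Z).card) :
    fwt q (sect F (T \ U) Y) ≤ lvb k (∑ i ∈ T \ U, q i) := by
  apply sect_le h.hq k hk
  intro X hX hXY
  have h1 := h.cross _ hXY _ hZ
  have h2 : Disjoint X (Y ∪ Z) :=
    disjoint_of_subset_left hX (disjoint_of_subset_right (union_subset hY hZU) sdiff_disjoint)
  rw [union_assoc, card_union_of_disjoint h2] at h1
  omega

/-- the alternative with one coordinate irrelevant -/
def fstar (T : Finset ι) (a : ι) : Finset (Finset ι) :=
  T.powerset.filter (fun X => (X.erase a).card ≤ 1)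

theorem fwt_star (q : ι → ℝ) {T : Finset ι} {a : ι} (ha : a ∈ T) :
    fwt q (fstar T a) = (1 + q a) * (1 + ∑ i ∈ T.erase a, q i) := by
  have hs : ∀ X ∈ fstar T a, X ⊆ T := by
    intro X hX; simp only [fstar, mem_filter, mem_powerset] at hX; exact hX.1
  rw [fwt_sect q (U := {a}) hs]
  have hl : ∀ Y ⊆ {a}, sect (fstar T a) (T \ {a}) Y = lev (T.erase a) 1 := by
    intro Y hY
    ext X
    rw [mem_sect, mem_lev, sdiff_singleton_eq_erase]
    simp only [fstar, mem_filter, mem_powerset]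
    have : ∀ hX : X ⊆ T.erase a, (X ∪ Y).erase a = X := by
      intro hX
      ext i
      simp only [mem_erase, mem_union]
      constructor
      · rintro ⟨h1, h2 | h2⟩
        · exact h2
        · exact absurd (mem_singleton.1 (hY h2)) h1
      · intro h; exact ⟨(mem_erase.1 (hX h)).1, Or.inl h⟩
    constructor
    · rintro ⟨h1, h2, h3⟩
      rw [this h1] at h3; exact ⟨h1, h3⟩
    · rintro ⟨h1, h2⟩
      rw [this h1]
      refine ⟨h1, union_subset (h1.trans (erase_subset _ _)) (hY.trans (by simpa using ha)), h2⟩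
  rw [sum_congr rfl (fun Y hY => by rw [hl Y (mem_powerset.1 hY), fwt_lev_one]), ← sum_mul]
  congr 1
  rw [← prod_one_add, prod_singleton]

theorem Cfg.star_le {q : ι → ℝ} {T : Finset ι} {F G : Finset (Finset ι)}
    (h : Cfg q T 3 F G) {a : ι} (ha : a ∈ T) :
    ((1 + q a) * (1 + ∑ i ∈ T.erase a, q i))^2 ≤ fwt q F * fwt q G := by
  rw [← fwt_star q ha]
  apply h.mx
  · intro X hX; simp only [fstar, mem_filter, mem_powerset] at hX; exact hX.1
  · intro X hX Y hY
    simp only [fstar, mem_filter, mem_powerset] at hX hY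
    have h1 : X ∪ Y ⊆ insert a (X.erase a ∪ Y.erase a) := by
      intro i; simp only [mem_union, mem_insert, mem_erase]; tauto
    have h2 := card_le_card h1
    have h3 := card_insert_le a (X.erase a ∪ Y.erase a)
    have h4 := card_union_le (X.erase a) (Y.erase a)
    omega

theorem Cfg.pow_le {q : ι → ℝ} {T : Finset ι} {t : ℕ} {F G : Finset (Finset ι)}
    (h : Cfg q T t F G) {Z : Finset ι} (hZ : Z ⊆ T) (hc : Z.card ≤ t) :
    (∏ i ∈ Z, (1 + q i))^2 ≤ fwt q F * fwt q G := by
  rw [← fwt_powerset]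
  apply h.mx
  · intro X hX; exact (mem_powerset.1 hX).trans hZ
  · intro X hX Y hY
    exact (card_le_card (union_subset (mem_powerset.1 hX) (mem_powerset.1 hY))).trans hc


end core

theorem ineq_G1 (a b t : ℝ) (hb : 2 ≤ b) (hab : b ≤ a) (ht : 0 ≤ t) :
    (1+a+b)*((1+t+t^2/2) + a*(1+t) + b*(1+t) + a*b*(1+t)) < ((1+a)*(1+(b+t)))^2 := by
  have ha : 2 ≤ a := by linarith
  have h1 : 1+a+b ≤ 2*(1+a) := by linarith
  have h0 : 0 ≤ (1+t+t^2/2) + a*(1+t) + b*(1+t) + a*b*(1+t) := by positivity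
  have h2 : (1+t+t^2/2) + a*(1+t) + b*(1+t) + a*b*(1+t) = (1+a)*((1+b)*(1+t)) + t^2/2 := by ring
  have h3 : (1+a)*((1+b)*(1+t)) + t^2/2 ≤ (1+a)*((1+b)*(1+t)+t^2/2) := by nlinarith [sq_nonneg t]
  have h4 : 2*((1+b)*(1+t)+t^2/2) < (1+(b+t))^2 := by nlinarith
  have h5 : 0 < (1+a)^2 := by positivity
  calc _ ≤ (2*(1+a)) * ((1+a)*((1+b)*(1+t)+t^2/2)) := by
        apply mul_le_mul h1 (h2 ▸ h3) h0 (by linarith)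
    _ = (1+a)^2*(2*((1+b)*(1+t)+t^2/2)) := by ring
    _ < (1+a)^2*(1+(b+t))^2 := by exact mul_lt_mul_of_pos_left h4 h5
    _ = _ := by ring

theorem ineq_G2 (a b c t : ℝ) (hb : 2 ≤ b) (hc : 2 ≤ c) (hab : b ≤ a) (hac : c ≤ a) (ht : 2 ≤ t) :
    (1+a+b+c)*((1+t+t^2/2) + a*(1+t) + b*(1+t) + c*(1+t) + a*b + a*c + b*c + a*b*c)
      < ((1+a)*(1+(b+c+t)))^2 := by
  have ha : 2 ≤ a := by linarith
  have h1 : 1+a+b+c ≤ 3*(1+a) := by linarith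
  have h0 : 0 ≤ (1+t+t^2/2) + a*(1+t) + b*(1+t) + c*(1+t) + a*b + a*c + b*c + a*b*c := by positivity
  have h3 : (1+t+t^2/2) + a*(1+t) + b*(1+t) + c*(1+t) + a*b + a*c + b*c + a*b*c
     ≤ (1+a)*(1+b+c+3*t+b*c + t^2/6) := by
    have : t^2/2 ≤ (1+a)*(t^2/6) := by nlinarith [sq_nonneg t]
    have : (b+c)*t ≤ (1+a)*(2*t) := by nlinarith
    nlinarith
  have h4 : 3*(1+b+c+3*t+b*c + t^2/6) < (1+(b+c+t))^2 := by
    nlinarith [sq_nonneg (b-c), mul_nonneg (sub_nonneg.2 hb) (sub_nonneg.2 ht), mul_nonneg (sub_nonneg.2 hc) (sub_nonneg.2 ht), mul_nonneg (sub_nonneg.2 hb) (sub_nonneg.2 hc)]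
  have h5 : 0 < (1+a)^2 := by positivity
  calc _ ≤ (3*(1+a)) * ((1+a)*(1+b+c+3*t+b*c + t^2/6)) := by
        apply mul_le_mul h1 h3 h0 (by linarith)
    _ = (1+a)^2*(3*(1+b+c+3*t+b*c + t^2/6)) := by ring
    _ < (1+a)^2*(1+(b+c+t))^2 := by exact mul_lt_mul_of_pos_left h4 h5
    _ = _ := by ring

theorem ineq_G3 (a b c t : ℝ) (hb : 2 ≤ b) (hc : 2 ≤ c) (hab : b ≤ a) (ht : 2 ≤ t)
    (hH : ((1+a)*(1+(b+c+t)))^2 ≤ (1+a+b+c+a*b)*((1+t) + a*(1+t) + b*(1+t) + c + a*b + a*c + b*c + a*b*c))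
    (hP : ((1+a)*((1+b)*(1+c)))^2 ≤ (1+a+b+c+a*b)*((1+t) + a*(1+t) + b*(1+t) + c + a*b + a*c + b*c + a*b*c)) :
    False := by
  have ha : 2 ≤ a := by linarith
  by_cases h : c*b^2 < t^2 + 4/3*(c*t)
  · apply absurd hH; rw [not_le]
    have e1 : (1+a+b+c+a*b) ≤ (1+a)*(1+b+c/(1+a)) := by
      have : (1+a)*(1+b+c/(1+a)) = (1+a)*(1+b)+c := by field_simp
      rw [this]; nlinarith
    have e2 : ((1+t) + a*(1+t) + b*(1+t) + c + a*b + a*c + b*c + a*b*c) ≤ (1+a)*((1+b)*(1+c)+2*t) := by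
      nlinarith
    have x : 0 ≤ c/(1+a) := by positivity
    have x1 : c/(1+a)*(1+b) ≤ c := by
      rw [div_mul_eq_mul_div, div_le_iff₀ (by linarith)]; nlinarith
    have x2 : c/(1+a)*3 ≤ c := by
      rw [div_mul_eq_mul_div, div_le_iff₀ (by linarith)]; nlinarith
    have e3 : (1+b+c/(1+a))*((1+b)*(1+c)+2*t) < (1+(b+c+t))^2 := by
      have y1 := mul_le_mul_of_nonneg_right x1 (by linarith : 0 ≤ 1 + c)
      have y2 := mul_le_mul_of_nonneg_right x2 (by linarith : 0 ≤ t)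
      generalize c/(1+a) = z at *
      nlinarith only [y1, y2, h]
    calc _ ≤ ((1+a)*(1+b+c/(1+a))) * ((1+a)*((1+b)*(1+c)+2*t)) := by
          apply mul_le_mul e1 e2 (by positivity) (by positivity)
      _ = (1+a)^2 * ((1+b+c/(1+a))*((1+b)*(1+c)+2*t)) := by ring
      _ < (1+a)^2 * (1+(b+c+t))^2 := mul_lt_mul_of_pos_left e3 (by positivity)
      _ = _ := by ring
  · push Not at h
    have h5 : 5*t < 4*(c*b) := by
      by_contra hh; push Not at hh
      have z0 : 0 ≤ c*b := by positivity
      have z1 : 16*(c*b)^2 ≤ 25*t^2 := by nlinarith only [z0, hh]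
      have z2 : 0 < c*t := by positivity
      have z3 : 32 * (c*b^2) ≤ 16*(c*b)^2 := by
        nlinarith only [mul_nonneg (mul_nonneg (by linarith : 0 ≤ c) (sq_nonneg b)) (sub_nonneg.2 hc)]
      have z4 : 0 < t^2 := by positivity
      linarith
    apply absurd hP; rw [not_le]
    obtain ⟨K, hK⟩ : ∃ K, K = (1+a)*(1+b) := ⟨_, rfl⟩
    have hK9 : 9 ≤ K := by rw [hK]; nlinarith only [ha, hb]
    have f1 : 27*(K + c) ≤ 11*(K*(1+c)) := by
      nlinarith only [hK9, hc, mul_nonneg (sub_nonneg.2 hK9) (sub_nonneg.2 hc)]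
    have f2 : (1+a+b)*b ≤ 2*(K-1) := by rw [hK]; nlinarith only [ha, hb, hab]
    have goal' : (K+c)*(t*(1+a+b)) < K*(1+c)*(c*(K-1)) := by
      have g1 : 5*(t*(1+a+b)) < 8*(c*(K-1)) := by
        have : 5*t*(1+a+b) < 4*(c*b)*(1+a+b) := mul_lt_mul_of_pos_right h5 (by linarith)
        have g0 : c*((1+a+b)*b) ≤ c*(2*(K-1)) := mul_le_mul_of_nonneg_left f2 (by linarith)
        nlinarith only [this, g0]
      have g2 : 0 < c*(K-1) := by apply mul_pos <;> linarith
      have g3 : 0 < K*(1+c) := by positivity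
      have g4 : 27*(K+c)*(5*(t*(1+a+b))) < 27*(K+c)*(8*(c*(K-1))) := mul_lt_mul_of_pos_left g1 (by positivity)
      have g5 : 27*(K+c)*(8*(c*(K-1))) ≤ 11*(K*(1+c))*(8*(c*(K-1))) :=
        mul_le_mul_of_nonneg_right f1 (by linarith)
      have g6 := mul_pos g3 g2
      nlinarith only [g4, g5, g6]
    have : (1+a+b+c+a*b) = K + c := by rw [hK]; ring
    rw [this]
    have : ((1+t) + a*(1+t) + b*(1+t) + c + a*b + a*c + b*c + a*b*c) = K*(1+c) + t*(1+a+b) := by rw [hK]; ring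
    rw [this]
    have : (1+a)*((1+b)*(1+c)) = K*(1+c) := by rw [hK]; ring
    rw [this]
    nlinarith only [goal']

theorem ineq_G5 (a b c t : ℝ) (ha : 2 ≤ a) (hb : 2 ≤ b) (hc : 2 ≤ c) (ht : 2 ≤ t)
    (hH : ((1+a)*(1+(b+c+t)))^2 ≤ (1+a+b+c+a*b+a*c+b*c)*((1+t) + a + b + c + a*b + a*c + b*c + a*b*c))
    (hP : ((1+a)*((1+b)*(1+c)))^2 ≤ (1+a+b+c+a*b+a*c+b*c)*((1+t) + a + b + c + a*b + a*c + b*c + a*b*c)) :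
    False := by
  set e := a*b*c with he
  have he0 : 0 < e := by positivity
  set K := (1+a)*((1+b)*(1+c)) with hK
  have k1 : 1+a+b+c+a*b+a*c+b*c = K - e := by rw [hK, he]; ring
  have k2 : (1+t) + a + b + c + a*b + a*c + b*c + e = K + t := by rw [hK, he]; ring
  rw [k1, k2] at hH hP
  have hKe : 0 < K - e := by rw [← k1]; positivity
  have h1 : e < t := by
    by_contra hh; push Not at hh
    nlinarith [mul_le_mul_of_nonneg_left hh hKe.le]
  have h2 : K + t ≤ (1+a)*(1+(b+c+t)) := by
    have : (1+a)*(1+(b+c+t)) = K + (1+a)*(t - b*c) := by rw [hK]; ring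
    rw [this]
    have : e = a * (b*c) := by rw [he]; ring
    have : 0 < b*c := by positivity
    nlinarith
  nlinarith

theorem ineq_T1 (a b t : ℝ) (hb : 2 ≤ b) (hab : b ≤ a) (ht : 2 ≤ t) :
    (1+(a+b+t)+a*b)*((1+t)+a*(1+t)+b*(1+t)+a*b) < ((1+a)*(1+(b+t)))^2 := by
  have ha : 2 ≤ a := by linarith
  have : (1+a)*(1+(b+t)) = (1+(a+b+t)+a*b) + a*t := by ring
  rw [this]
  set V := (1+(a+b+t)+a*b) with hV
  have : ((1+t)+a*(1+t)+b*(1+t)+a*b) = V + a*t+b*t := by rw [hV]; ring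
  rw [this]
  have : 0 < V := by rw [hV]; positivity
  have : 0 < a*t := by positivity
  have : b*t ≤ a*t := by nlinarith
  nlinarith

theorem ineq_T2 (a b c t : ℝ) (ha : 2 ≤ a) (hb : 2 ≤ b) (hc : 2 ≤ c) (ht : 2 ≤ t)
    (hH : ((1+a)*(1+(b+c+t)))^2 ≤ (1+(a+b+c+t)+a*b+a*c)*((1+t) + a*(1+t) + b + c + a*b + a*c + b*c))
    (hP : ((1+a)*((1+b)*(1+c)))^2 ≤ (1+(a+b+c+t)+a*b+a*c)*((1+t) + a*(1+t) + b + c + a*b + a*c + b*c)) :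
    False := by
  set V := (1+(a+b+c+t)+a*b+a*c) with hV
  have k1 : (1+a)*(1+(b+c+t)) = V + a*t := by rw [hV]; ring
  have k2 : ((1+t) + a*(1+t) + b + c + a*b + a*c + b*c) = V + a*t + b*c := by rw [hV]; ring
  have k3 : (1+a)*((1+b)*(1+c)) = V - t + b*c+a*(b*c) := by rw [hV]; ring
  rw [k2, k1] at hH
  rw [k2, k3] at hP
  have hV0 : 0 < V := by rw [hV]; positivity
  have : 0 < a*t := by positivity
  have h1 : a*t < b*c := by
    by_contra hh; push Not at hh
    nlinarith [mul_le_mul_of_nonneg_left hh hV0.le]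
  have : t ≤ a*(b*c) := by nlinarith
  have : (V+b*c)^2 ≤ (V - t + b*c+a*(b*c))^2 := by
    apply pow_le_pow_left₀ (by positivity); linarith
  nlinarith [mul_lt_mul_of_pos_left h1 hV0]

theorem ineq_T3 (a b c t : ℝ) (ha : 2 ≤ a) (hb : 2 ≤ b) (hc : 2 ≤ c) (ht : 2 ≤ t)
    (hH : ((1+a)*(1+(b+c+t)))^2 ≤ (1+(a+b+c+t)+a*b+a*c+b*c)*(1+(a+b+c+t)+a*b+a*c+b*c))
    (hP : ((1+a)*((1+b)*(1+c)))^2 ≤ (1+(a+b+c+t)+a*b+a*c+b*c)*(1+(a+b+c+t)+a*b+a*c+b*c)) :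
    False := by
  rw [← pow_two] at hH hP
  have h1 := le_of_abs_le (abs_le_of_sq_le_sq hH (by positivity))
  have h2 := le_of_abs_le (abs_le_of_sq_le_sq hP (by positivity))
  have : a*(b*c) ≤ t := by nlinarith
  have : 0 < b*c := by positivity
  nlinarith

theorem ineq_T4 (a b c d t : ℝ) (hb : 2 ≤ b) (hc : 2 ≤ c) (hd : 2 ≤ d) (hab : b ≤ a) (hac : c ≤ a) (had : d ≤ a) (ht : 0 ≤ t) :
    (1+(a+b+c+d+t)+a*b+c*d)*(1+(a+b+c+d+t)+a*c+a*d+b*c+b*d) < ((1+a)*(1+(b+c+d+t)))^2 := by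
  have ha : 2 ≤ a := by linarith
  set W := (1+(a+b+c+d+t)) with hW
  have : (1+a)*(1+(b+c+d+t)) = W + a*(b+c+d+t) := by rw [hW]; ring
  rw [this]
  have : 0 < W := by rw [hW]; positivity
  have hs : (W + a*b+c*d) + (W+a*c+a*d+b*c+b*d) ≤ 2*(W + a*(b+c+d+t)) := by
    have : 0 ≤ a*t := by apply mul_nonneg <;> linarith
    nlinarith
  have hne : (W + a*b+c*d) ≠ (W+a*c+a*d+b*c+b*d) ∨ (W + a*b+c*d) + (W+a*c+a*d+b*c+b*d) < 2*(W + a*(b+c+d+t)) := by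
    by_contra hh; push Not at hh
    obtain ⟨h1, h2⟩ := hh
    have : 0 ≤ a*t := by apply mul_nonneg <;> linarith
    have hca : c = a := by nlinarith
    have hda : d = a := by nlinarith
    subst hca; subst hda
    nlinarith
  set x := (W + a*b+c*d)
  set y := (W+a*c+a*d+b*c+b*d)
  have hx : 0 < x := by positivity
  have hy : 0 < y := by positivity
  rcases hne with h | h
  · have := sq_pos_of_ne_zero (sub_ne_zero.2 h)
    nlinarith
  · nlinarith [sq_nonneg (x-y)]

-- path a-b-c-d and a-c-b-d; b ≥ c
theorem ineq_T5 (a b c d t : ℝ) (ha : 2 ≤ a) (hc : 2 ≤ c) (hd : 2 ≤ d) (hbc : c ≤ b) (ht : 0 ≤ t)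
    (ht2 : t = 0 ∨ 2 ≤ t)
    (hH : ((1+b)*(1+(a+c+d+t)))^2 ≤ (1+(a+b+c+d+t)+a*b+b*c+c*d)*(1+(a+b+c+d+t)+a*c+b*c+b*d))
    (hP : ((1+b)*((1+a)*(1+c)))^2 ≤ (1+(a+b+c+d+t)+a*b+b*c+c*d)*(1+(a+b+c+d+t)+a*c+b*c+b*d))
    (hP2 : ((1+b)*((1+c)*(1+d)))^2 ≤ (1+(a+b+c+d+t)+a*b+b*c+c*d)*(1+(a+b+c+d+t)+a*c+b*c+b*d)) :
    False := by
  have hb : 2 ≤ b := by linarith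
  have hle : (1+(a+b+c+d+t)+a*b+b*c+c*d)*(1+(a+b+c+d+t)+a*c+b*c+b*d) ≤
    ((1+b)*(1+(a+c+d)) + t)^2 := by
    rw [pow_two]
    apply mul_le_mul _ _ (by positivity) (by positivity)
    · nlinarith
    · nlinarith
  have h3 : (1+b)*(1+(a+c+d+t)) ≤ ((1+b)*(1+(a+c+d)) + t) :=
    le_of_abs_le (abs_le_of_sq_le_sq (hH.trans hle) (by positivity))
  have ht0 : t = 0 := by
    rcases ht2 with h | h
    · exact h
    · exfalso; nlinarith only [h, h3, hb]
  subst ht0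
  have h4 := le_of_abs_le (abs_le_of_sq_le_sq (hP.trans hle) (by positivity))
  have h5 := le_of_abs_le (abs_le_of_sq_le_sq (hP2.trans hle) (by positivity))
  have h6 : (1+a)*(1+c) ≤ 1+(a+c+d) := by
    have : 0 < 1 + b := by linarith
    exact le_of_mul_le_mul_left (by linarith) this
  have h7 : (1+c)*(1+d) ≤ 1+(a+c+d) := by
    have : 0 < 1 + b := by linarith
    exact le_of_mul_le_mul_left (by linarith) this
  nlinarith only [h6, h7, ha, hc, hd]

theorem ineq_t2 (a b t : ℝ) (ha : 2 ≤ a) (hb : 2 ≤ b) (ht : 2 ≤ t)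
    (hH : (1+(a+b+t))^2 ≤ (1+a+b)*(1+(a+b+t)+a*b))
    (hP : ((1+a)*(1+b))^2 ≤ (1+a+b)*(1+(a+b+t)+a*b)) : False := by
  have h1 : a*b < t := by
    by_contra hh; push Not at hh
    have : 0 < 1 + a + b := by positivity
    have : 0 < a*b := by positivity
    nlinarith
  have : 0 < a*b := by positivity
  nlinarith

section core
variable {ι : Type*} [DecidableEq ι]
set_option linter.unusedSectionVars false

theorem tau_ge {q : ι → ℝ} {T U : Finset ι} (hq : ∀ i ∈ T, 2 ≤ q i) (h : U.card < T.card) :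
    2 ≤ ∑ i ∈ T \ U, q i := by
  have h1 : (T \ U).Nonempty := by
    rw [sdiff_nonempty]; intro hs; have := card_le_card hs; omega
  obtain ⟨i, hi⟩ := h1
  have hq' : ∀ i ∈ T \ U, 2 ≤ q i := fun i hi => hq i (mem_sdiff.1 hi).1
  have := single_le_sum (f := q) (fun i hi => by have := hq' i hi; linarith) hi
  have := hq' i hi
  linarith

theorem tau_nonneg {q : ι → ℝ} {T U : Finset ι} (hq : ∀ i ∈ T, 2 ≤ q i) :
    0 ≤ ∑ i ∈ T \ U, q i :=
  sum_nonneg (fun i hi => by have := hq i (mem_sdiff.1 hi).1; linarith)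

theorem tau_zero_or {q : ι → ℝ} {T U : Finset ι} (hq : ∀ i ∈ T, 2 ≤ q i) :
    ∑ i ∈ T \ U, q i = 0 ∨ 2 ≤ ∑ i ∈ T \ U, q i := by
  rcases (T \ U).eq_empty_or_nonempty with h | ⟨i, hi⟩
  · left; rw [h]; simp
  · right
    have hq' : ∀ i ∈ T \ U, 2 ≤ q i := fun i hi => hq i (mem_sdiff.1 hi).1
    have := single_le_sum (f := q) (fun i hi => by have := hq' i hi; linarith) hi
    have := hq' i hi
    linarith

theorem fwt_sect2 (q : ι → ℝ) {T : Finset ι} {F : Finset (Finset ι)} {a b : ι} (hab : a ≠ b)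
    (hF : ∀ X ∈ F, X ⊆ T) :
    fwt q F = fwt q (sect F (T \ {a,b}) ∅) + q a * fwt q (sect F (T \ {a,b}) {a})
      + q b * fwt q (sect F (T \ {a,b}) {b}) + q a * q b * fwt q (sect F (T \ {a,b}) {a,b}) := by
  rw [fwt_sect q (U := {a,b}) hF, sum_powerset_insert (by simpa using hab)]
  rw [show ({b} : Finset ι) = insert b ∅ from rfl, sum_powerset_insert (by simp),
    sum_powerset_insert (by simp)]
  simp [hab]
  ring

theorem fwt_sect3 (q : ι → ℝ) {T : Finset ι} {F : Finset (Finset ι)} {a b c : ι} (hab : a ≠ b)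
    (hac : a ≠ c) (hbc : b ≠ c)
    (hF : ∀ X ∈ F, X ⊆ T) :
    fwt q F = fwt q (sect F (T \ {a,b,c}) ∅) + q a * fwt q (sect F (T \ {a,b,c}) {a})
      + q b * fwt q (sect F (T \ {a,b,c}) {b}) + q c * fwt q (sect F (T \ {a,b,c}) {c})
      + q a * q b * fwt q (sect F (T \ {a,b,c}) {a,b})
      + q a * q c * fwt q (sect F (T \ {a,b,c}) {a,c})
      + q b * q c * fwt q (sect F (T \ {a,b,c}) {b,c})
      + q a * q b * q c * fwt q (sect F (T \ {a,b,c}) {a,b,c}) := by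
  rw [fwt_sect q (U := {a,b,c}) hF, sum_powerset_insert (by simp [hab, hac])]
  rw [sum_powerset_insert (by simpa using hbc), sum_powerset_insert (by simpa using hbc)]
  rw [show ({c} : Finset ι) = insert c ∅ from rfl]
  simp only [sum_powerset_insert (show c ∉ (∅ : Finset ι) by simp)]
  simp [hab, hac, hbc]
  ring

theorem sum2 (q : ι → ℝ) {T : Finset ι} {a b : ι} (hab : a ≠ b) (ha : a ∈ T) (hb : b ∈ T) :
    ∑ i ∈ T, q i = q a + q b + ∑ i ∈ T \ {a,b}, q i := by
  rw [← sum_sdiff (show {a,b} ⊆ T by simp [insert_subset_iff, ha, hb]), sum_pair hab]; ring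

theorem sum3 (q : ι → ℝ) {T : Finset ι} {a b c : ι} (hab : a ≠ b) (hac : a ≠ c) (hbc : b ≠ c)
    (ha : a ∈ T) (hb : b ∈ T) (hc : c ∈ T) :
    ∑ i ∈ T, q i = q a + q b + q c + ∑ i ∈ T \ {a,b,c}, q i := by
  rw [← sum_sdiff (show {a,b,c} ⊆ T by simp [insert_subset_iff, ha, hb, hc]),
    sum_insert (by simp [hab, hac]), sum_pair hbc]; ring

theorem sum4 (q : ι → ℝ) {T : Finset ι} {a b c d : ι} (hab : a ≠ b) (hac : a ≠ c) (had : a ≠ d)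
    (hbc : b ≠ c) (hbd : b ≠ d) (hcd : c ≠ d)
    (ha : a ∈ T) (hb : b ∈ T) (hc : c ∈ T) (hd : d ∈ T) :
    ∑ i ∈ T, q i = q a + q b + q c + q d + ∑ i ∈ T \ {a,b,c,d}, q i := by
  rw [← sum_sdiff (show {a,b,c,d} ⊆ T by simp [insert_subset_iff, ha, hb, hc, hd]),
    sum_insert (by simp [hab, hac, had]), sum_insert (by simp [hbc, hbd]), sum_pair hcd]; ring

theorem sumErase (q : ι → ℝ) {T : Finset ι} {a : ι} (ha : a ∈ T) :
    ∑ i ∈ T.erase a, q i = ∑ i ∈ T, q i - q a := by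
  rw [← sum_erase_add T q ha]; ring

theorem Cfg.star_le' {q : ι → ℝ} {T : Finset ι} {F G : Finset (Finset ι)}
    (h : Cfg q T 3 F G) {a : ι} (ha : a ∈ T) (s : ℝ) (hs : ∑ i ∈ T, q i = q a + s) :
    ((1 + q a) * (1 + s))^2 ≤ fwt q F * fwt q G := by
  have := h.star_le ha
  rw [sumErase q ha, hs] at this
  simpa using this

theorem Cfg.pow3_le {q : ι → ℝ} {T : Finset ι} {F G : Finset (Finset ι)}
    (h : Cfg q T 3 F G) {a b c : ι} (hab : a ≠ b) (hac : a ≠ c) (hbc : b ≠ c)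
    (ha : a ∈ T) (hb : b ∈ T) (hc : c ∈ T) :
    ((1 + q a) * ((1 + q b) * (1 + q c)))^2 ≤ fwt q F * fwt q G := by
  have := h.pow_le (Z := {a,b,c}) (by simp [insert_subset_iff, ha, hb, hc]) card_le_three
  rwa [prod_insert (by simp [hab, hac]), prod_pair hbc] at this

theorem fwt_empty (q : ι → ℝ) : fwt q ∅ = 0 := by simp [fwt]

/-- list bound: families inside `{∅, a, b}` etc. -/
theorem fwt_le_union {q : ι → ℝ} {T : Finset ι} (hq : ∀ i ∈ T, 2 ≤ q i)
    {F H K : Finset (Finset ι)} (hF : F ⊆ H ∪ K) (hH : ∀ X ∈ H, X ⊆ T) (hK : ∀ X ∈ K, X ⊆ T) :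
    fwt q F ≤ fwt q H + fwt q K := by
  have h1 := fwt_mono hq hF (by intro X hX; rcases mem_union.1 hX with h | h; exacts [hH X h, hK X h])
  have h2 : fwt q (H ∪ K) + fwt q (H ∩ K) = fwt q H + fwt q K := sum_union_inter
  have h3 : 0 ≤ fwt q (H ∩ K) := fwt_nonneg hq (fun X hX => hH X (mem_inter.1 hX).1)
  linarith

theorem Cfg.T2 {q : ι → ℝ} {T : Finset ι} {t : ℕ} {F G : Finset (Finset ι)}
    (h : Cfg q T t F G) : 0 ≤ fwt q F ∧ 0 ≤ fwt q G :=
  ⟨fwt_nonneg h.hq h.subF, fwt_nonneg h.hq h.subG⟩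

/-- general bound with two special coordinates -/
theorem bd2 {q : ι → ℝ} {T : Finset ι} {F : Finset (Finset ι)} {a b : ι} (hab : a ≠ b)
    (hF : ∀ X ∈ F, X ⊆ T) (ha : 2 ≤ q a) (hb : 2 ≤ q b)
    {k0 k1 k2 k3 : ℝ}
    (h0 : fwt q (sect F (T \ {a,b}) ∅) ≤ k0) (h1 : fwt q (sect F (T \ {a,b}) {a}) ≤ k1)
    (h2 : fwt q (sect F (T \ {a,b}) {b}) ≤ k2) (h3 : fwt q (sect F (T \ {a,b}) {a,b}) ≤ k3) :
    fwt q F ≤ k0 + q a * k1 + q b * k2 + q a * q b * k3 := by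
  rw [fwt_sect2 q hab hF]
  gcongr

theorem Cfg.caseG1 {q : ι → ℝ} {T : Finset ι} {F G : Finset (Finset ι)}
    (h : Cfg q T 3 F G) {a b : ι} (hab : a ≠ b) (ha : {a} ∈ G) (hb : {b} ∈ G)
    (hG : G ⊆ {∅, {a}, {b}}) (hle : q b ≤ q a) : False := by
  have haT : a ∈ T := h.subG _ ha (by simp)
  have hbT : b ∈ T := h.subG _ hb (by simp)
  have hsum := sum2 q hab haT hbT
  have ht : 2 ≤ ∑ i ∈ T \ {a,b}, q i := tau_ge h.hq (by have := h.hT; have := card_le_two (a := a) (b := b); omega)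
  have b0 := h.sect_bd (U := {a,b}) (Y := ∅) ha (by simp) (by simp) 2 (by simp) (by simp)
  have b1 := h.sect_bd (U := {a,b}) (Y := {a}) hb (by simp) (by simp) 1 (by simp)
    (by simp [← insert_eq, card_pair hab])
  have b2 := h.sect_bd (U := {a,b}) (Y := {b}) ha (by simp) (by simp) 1 (by simp)
    (by rw [union_comm]; simp [← insert_eq, card_pair hab])
  have b3 := h.sect_bd (U := {a,b}) (Y := {a,b}) ha (by simp) (by simp) 1 (by simp)
    (by rw [union_eq_left.2 (by simp), card_pair hab])
  have eG : fwt q G ≤ 1 + q a + q b := by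
    have h1 := fwt_mono h.hq hG (by simp [haT, hbT])
    have h2 := fwt_insert_le h.hq (H := {{a},{b}}) ∅ (by simp)
    have h3 := fwt_insert_le h.hq (H := {{b}}) {a} (by simpa using haT)
    have h4 := fwt_insert_le h.hq (H := ∅) {b} (by simpa using hbT)
    simp only [prod_singleton, prod_empty, fwt_empty, insert_empty_eq] at h2 h3 h4
    linarith
  have hst := h.star_le' haT _ (by rw [hsum, add_assoc])
  have hqa := h.hq a haT
  have hqb := h.hq b hbT
  have key := ineq_G1 (q a) (q b) _ hqb hle (by linarith : 0 ≤ ∑ i ∈ T \ {a,b}, q i)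
  have eF := bd2 hab h.subF hqa hqb b0 b1 b2 b3
  have : fwt q F * fwt q G ≤ _ := mul_le_mul eF eG h.T2.2 (by simp only [lvb]; positivity)
  rw [mul_comm _ (1 + q a + q b)] at this
  simp only [lvb, mul_one] at this
  exact absurd (hst.trans this) (not_le.2 key)

/-- general bound with three special coordinates -/
theorem bd3 {q : ι → ℝ} {T : Finset ι} {F : Finset (Finset ι)} {a b c : ι} (hab : a ≠ b)
    (hac : a ≠ c) (hbc : b ≠ c) (hF : ∀ X ∈ F, X ⊆ T) (ha : 2 ≤ q a) (hb : 2 ≤ q b) (hc : 2 ≤ q c)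
    {k0 k1 k2 k3 k4 k5 k6 k7 : ℝ}
    (h0 : fwt q (sect F (T \ {a,b,c}) ∅) ≤ k0) (h1 : fwt q (sect F (T \ {a,b,c}) {a}) ≤ k1)
    (h2 : fwt q (sect F (T \ {a,b,c}) {b}) ≤ k2) (h3 : fwt q (sect F (T \ {a,b,c}) {c}) ≤ k3)
    (h4 : fwt q (sect F (T \ {a,b,c}) {a,b}) ≤ k4) (h5 : fwt q (sect F (T \ {a,b,c}) {a,c}) ≤ k5)
    (h6 : fwt q (sect F (T \ {a,b,c}) {b,c}) ≤ k6)
    (h7 : fwt q (sect F (T \ {a,b,c}) {a,b,c}) ≤ k7) :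
    fwt q F ≤ k0 + q a * k1 + q b * k2 + q c * k3 + q a * q b * k4 + q a * q c * k5
      + q b * q c * k6 + q a * q b * q c * k7 := by
  rw [fwt_sect3 q hab hac hbc hF]
  gcongr

theorem Cfg.caseG2 {q : ι → ℝ} {T : Finset ι} {F G : Finset (Finset ι)}
    (h : Cfg q T 3 F G) {a b c : ι} (hab : a ≠ b) (hac : a ≠ c) (hbc : b ≠ c)
    (ha : {a} ∈ G) (hb : {b} ∈ G) (hc : {c} ∈ G)
    (hG : G ⊆ {∅, {a}, {b}, {c}}) (hle : q b ≤ q a) (hle2 : q c ≤ q a) : False := by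
  have haT : a ∈ T := h.subG _ ha (by simp)
  have hbT : b ∈ T := h.subG _ hb (by simp)
  have hcT : c ∈ T := h.subG _ hc (by simp)
  have hqa := h.hq a haT
  have hqb := h.hq b hbT
  have hqc := h.hq c hcT
  have hsum := sum3 q hab hac hbc haT hbT hcT
  have c3 : ({a,b,c} : Finset ι).card = 3 := card_eq_three.2 ⟨a,b,c,hab,hac,hbc,rfl⟩
  have ht : 2 ≤ ∑ i ∈ T \ {a,b,c}, q i := tau_ge h.hq (by have := h.hT; omega)
  have b0 := h.sect_bd (U := {a,b,c}) (Y := ∅) ha (by simp) (by simp) 2 (by simp) (by simp)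
  have b1 := h.sect_bd (U := {a,b,c}) (Y := {a}) hb (by simp) (by simp) 1 (by simp)
    (by simp [← insert_eq, card_pair hab])
  have b2 := h.sect_bd (U := {a,b,c}) (Y := {b}) ha (by simp) (by simp) 1 (by simp)
    (by simp [← insert_eq, card_pair hab.symm])
  have b3 := h.sect_bd (U := {a,b,c}) (Y := {c}) ha (by simp) (by simp) 1 (by simp)
    (by simp [← insert_eq, card_pair hac.symm])
  have b4 := h.sect_bd (U := {a,b,c}) (Y := {a,b}) hc (by simp) (by simp [insert_subset_iff]) 0 (by simp)
    (by rw [show ({a,b} ∪ {c} : Finset ι) = {a,b,c} by grind, c3])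
  have b5 := h.sect_bd (U := {a,b,c}) (Y := {a,c}) hb (by simp) (by simp [insert_subset_iff]) 0 (by simp)
    (by rw [show ({a,c} ∪ {b} : Finset ι) = {a,b,c} by grind, c3])
  have b6 := h.sect_bd (U := {a,b,c}) (Y := {b,c}) ha (by simp) (by simp [insert_subset_iff]) 0 (by simp)
    (by rw [show ({b,c} ∪ {a} : Finset ι) = {a,b,c} by grind, c3])
  have b7 := h.sect_bd (U := {a,b,c}) (Y := {a,b,c}) ha (by simp) (by simp) 0 (by simp)
    (by rw [show ({a,b,c} ∪ {a} : Finset ι) = {a,b,c} by grind, c3])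
  have eF := bd3 hab hac hbc h.subF hqa hqb hqc b0 b1 b2 b3 b4 b5 b6 b7
  have eG : fwt q G ≤ 1 + q a + q b + q c := by
    have h1 := fwt_mono h.hq hG (by simp [haT, hbT, hcT])
    have h2 := fwt_insert_le h.hq (H := {{a},{b},{c}}) ∅ (by simp)
    have h3 := fwt_insert_le h.hq (H := {{b},{c}}) {a} (by simpa using haT)
    have h4 := fwt_insert_le h.hq (H := {{c}}) {b} (by simpa using hbT)
    have h5 := fwt_insert_le h.hq (H := ∅) {c} (by simpa using hcT)
    simp only [prod_singleton, prod_empty, fwt_empty, insert_empty_eq] at h2 h3 h4 h5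
    linarith
  have hst := h.star_le' haT (q b + q c + ∑ i ∈ T \ {a,b,c}, q i) (by rw [hsum]; ring)
  have key := ineq_G2 (q a) (q b) (q c) _ hqb hqc hle hle2 ht
  have : fwt q F * fwt q G ≤ _ := mul_le_mul eF eG h.T2.2 (by simp only [lvb]; positivity)
  rw [mul_comm _ (1 + q a + q b + q c)] at this
  simp only [lvb, mul_one] at this
  exact absurd (hst.trans this) (not_le.2 key)

theorem Cfg.caseG3 {q : ι → ℝ} {T : Finset ι} {F G : Finset (Finset ι)}
    (h : Cfg q T 3 F G) {a b c : ι} (hab : a ≠ b) (hac : a ≠ c) (hbc : b ≠ c)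
    (hc : {c} ∈ G) (habG : {a, b} ∈ G)
    (hG : G ⊆ {∅, {a}, {b}, {c}, {a, b}}) (hle : q b ≤ q a) : False := by
  have haT : a ∈ T := h.subG _ habG (by simp)
  have hbT : b ∈ T := h.subG _ habG (by simp)
  have hcT : c ∈ T := h.subG _ hc (by simp)
  have hqa := h.hq a haT
  have hqb := h.hq b hbT
  have hqc := h.hq c hcT
  have hsum := sum3 q hab hac hbc haT hbT hcT
  have c2 := card_pair hab
  have c3 : ({a,b,c} : Finset ι).card = 3 := card_eq_three.2 ⟨a,b,c,hab,hac,hbc,rfl⟩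
  have ht : 2 ≤ ∑ i ∈ T \ {a,b,c}, q i := tau_ge h.hq (by have := h.hT; omega)
  have sab : ({a,b} : Finset ι) ⊆ {a,b,c} := by simp [insert_subset_iff]
  have b0 := h.sect_bd (U := {a,b,c}) (Y := ∅) habG sab (by simp) 1 (by simp) (by simp [c2])
  have b1 := h.sect_bd (U := {a,b,c}) (Y := {a}) habG sab (by simp) 1 (by simp)
    (by rw [show ({a} ∪ {a,b} : Finset ι) = {a,b} by grind, c2])
  have b2 := h.sect_bd (U := {a,b,c}) (Y := {b}) habG sab (by simp) 1 (by simp)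
    (by rw [show ({b} ∪ {a,b} : Finset ι) = {a,b} by grind, c2])
  have b3 := h.sect_bd (U := {a,b,c}) (Y := {c}) habG sab (by simp) 0 (by simp)
    (by rw [show ({c} ∪ {a,b} : Finset ι) = {a,b,c} by grind, c3])
  have b4 := h.sect_bd (U := {a,b,c}) (Y := {a,b}) hc (by simp) (by simp [insert_subset_iff]) 0 (by simp)
    (by rw [show ({a,b} ∪ {c} : Finset ι) = {a,b,c} by grind, c3])
  have b5 := h.sect_bd (U := {a,b,c}) (Y := {a,c}) habG sab (by simp [insert_subset_iff]) 0 (by simp)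
    (by rw [show ({a,c} ∪ {a,b} : Finset ι) = {a,b,c} by grind, c3])
  have b6 := h.sect_bd (U := {a,b,c}) (Y := {b,c}) habG sab (by simp [insert_subset_iff]) 0 (by simp)
    (by rw [show ({b,c} ∪ {a,b} : Finset ι) = {a,b,c} by grind, c3])
  have b7 := h.sect_bd (U := {a,b,c}) (Y := {a,b,c}) hc (by simp) (by simp) 0 (by simp)
    (by rw [show ({a,b,c} ∪ {c} : Finset ι) = {a,b,c} by grind, c3])
  have eF := bd3 hab hac hbc h.subF hqa hqb hqc b0 b1 b2 b3 b4 b5 b6 b7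
  have eG : fwt q G ≤ 1 + q a + q b + q c + q a * q b := by
    have h1 := fwt_mono h.hq hG (by simp [haT, hbT, hcT, insert_subset_iff])
    have h2 := fwt_insert_le h.hq (H := {{a},{b},{c},{a,b}}) ∅ (by simp)
    have h3 := fwt_insert_le h.hq (H := {{b},{c},{a,b}}) {a} (by simpa using haT)
    have h4 := fwt_insert_le h.hq (H := {{c},{a,b}}) {b} (by simpa using hbT)
    have h5 := fwt_insert_le h.hq (H := {{a,b}}) {c} (by simpa using hcT)
    have h6 := fwt_insert_le h.hq (H := ∅) {a,b} (by simp [insert_subset_iff, haT, hbT])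
    simp only [prod_singleton, prod_empty, fwt_empty, insert_empty_eq, prod_pair hab] at h2 h3 h4 h5 h6
    linarith
  have hst := h.star_le' haT (q b + q c + ∑ i ∈ T \ {a,b,c}, q i) (by rw [hsum]; ring)
  have hpw := h.pow3_le hab hac hbc haT hbT hcT
  have : fwt q F * fwt q G ≤ _ := mul_le_mul eF eG h.T2.2 (by simp only [lvb]; positivity)
  rw [mul_comm _ (1 + q a + q b + q c + q a * q b)] at this
  simp only [lvb, mul_one] at this
  exact ineq_G3 (q a) (q b) (q c) _ hqb hqc hle ht (hst.trans this) (hpw.trans this)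

theorem Cfg.caseG5 {q : ι → ℝ} {T : Finset ι} {F G : Finset (Finset ι)}
    (h : Cfg q T 3 F G) {a b c : ι} (hab : a ≠ b) (hac : a ≠ c) (hbc : b ≠ c)
    (habG : {a, b} ∈ G) (hacG : {a, c} ∈ G) (hbcG : {b, c} ∈ G)
    (hG : G ⊆ {∅, {a}, {b}, {c}, {a, b}, {a, c}, {b, c}}) : False := by
  have haT : a ∈ T := h.subG _ habG (by simp)
  have hbT : b ∈ T := h.subG _ habG (by simp)
  have hcT : c ∈ T := h.subG _ hacG (by simp)
  have hqa := h.hq a haT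
  have hqb := h.hq b hbT
  have hqc := h.hq c hcT
  have hsum := sum3 q hab hac hbc haT hbT hcT
  have c2 := card_pair hab
  have c3 : ({a,b,c} : Finset ι).card = 3 := card_eq_three.2 ⟨a,b,c,hab,hac,hbc,rfl⟩
  have ht : 2 ≤ ∑ i ∈ T \ {a,b,c}, q i := tau_ge h.hq (by have := h.hT; omega)
  have sab : ({a,b} : Finset ι) ⊆ {a,b,c} := by simp [insert_subset_iff]
  have sac : ({a,c} : Finset ι) ⊆ {a,b,c} := by simp [insert_subset_iff]
  have sbc : ({b,c} : Finset ι) ⊆ {a,b,c} := by simp [insert_subset_iff]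
  have b0 := h.sect_bd (U := {a,b,c}) (Y := ∅) habG sab (by simp) 1 (by simp) (by simp [c2])
  have b1 := h.sect_bd (U := {a,b,c}) (Y := {a}) hbcG sbc (by simp) 0 (by simp)
    (by rw [show ({a} ∪ {b,c} : Finset ι) = {a,b,c} by grind, c3])
  have b2 := h.sect_bd (U := {a,b,c}) (Y := {b}) hacG sac (by simp) 0 (by simp)
    (by rw [show ({b} ∪ {a,c} : Finset ι) = {a,b,c} by grind, c3])
  have b3 := h.sect_bd (U := {a,b,c}) (Y := {c}) habG sab (by simp) 0 (by simp)
    (by rw [show ({c} ∪ {a,b} : Finset ι) = {a,b,c} by grind, c3])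
  have b4 := h.sect_bd (U := {a,b,c}) (Y := {a,b}) hacG sac (by simp [insert_subset_iff]) 0 (by simp)
    (by rw [show ({a,b} ∪ {a,c} : Finset ι) = {a,b,c} by grind, c3])
  have b5 := h.sect_bd (U := {a,b,c}) (Y := {a,c}) habG sab (by simp [insert_subset_iff]) 0 (by simp)
    (by rw [show ({a,c} ∪ {a,b} : Finset ι) = {a,b,c} by grind, c3])
  have b6 := h.sect_bd (U := {a,b,c}) (Y := {b,c}) habG sab (by simp [insert_subset_iff]) 0 (by simp)
    (by rw [show ({b,c} ∪ {a,b} : Finset ι) = {a,b,c} by grind, c3])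
  have b7 := h.sect_bd (U := {a,b,c}) (Y := {a,b,c}) habG sab (by simp) 0 (by simp)
    (by rw [show ({a,b,c} ∪ {a,b} : Finset ι) = {a,b,c} by grind, c3])
  have eF := bd3 hab hac hbc h.subF hqa hqb hqc b0 b1 b2 b3 b4 b5 b6 b7
  have eG : fwt q G ≤ 1 + q a + q b + q c + q a * q b + q a * q c + q b * q c := by
    have h1 := fwt_mono h.hq hG (by simp [haT, hbT, hcT, insert_subset_iff])
    have h2 := fwt_insert_le h.hq (H := {{a},{b},{c},{a,b},{a,c},{b,c}}) ∅ (by simp)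
    have h3 := fwt_insert_le h.hq (H := {{b},{c},{a,b},{a,c},{b,c}}) {a} (by simpa using haT)
    have h4 := fwt_insert_le h.hq (H := {{c},{a,b},{a,c},{b,c}}) {b} (by simpa using hbT)
    have h5 := fwt_insert_le h.hq (H := {{a,b},{a,c},{b,c}}) {c} (by simpa using hcT)
    have h6 := fwt_insert_le h.hq (H := {{a,c},{b,c}}) {a,b} (by simp [insert_subset_iff, haT, hbT])
    have h7 := fwt_insert_le h.hq (H := {{b,c}}) {a,c} (by simp [insert_subset_iff, haT, hcT])
    have h8 := fwt_insert_le h.hq (H := ∅) {b,c} (by simp [insert_subset_iff, hbT, hcT])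
    simp only [prod_singleton, prod_empty, fwt_empty, insert_empty_eq, prod_pair hab, prod_pair hac, prod_pair hbc] at h2 h3 h4 h5 h6 h7 h8
    linarith
  have hst := h.star_le' haT (q b + q c + ∑ i ∈ T \ {a,b,c}, q i) (by rw [hsum]; ring)
  have hpw := h.pow3_le hab hac hbc haT hbT hcT
  have : fwt q F * fwt q G ≤ _ := mul_le_mul eF eG h.T2.2 (by simp only [lvb]; positivity)
  rw [mul_comm _ (1 + q a + q b + q c + q a * q b + q a * q c + q b * q c)] at this
  simp only [lvb, mul_one] at this
  exact ineq_G5 (q a) (q b) (q c) _ hqa hqb hqc ht (hst.trans this) (hpw.trans this)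


end core

section core
variable {ι : Type*} [DecidableEq ι]
set_option linter.unusedSectionVars false

theorem edge_bd {q : ι → ℝ} {T : Finset ι} (hq : ∀ i ∈ T, 2 ≤ q i) {F E : Finset (Finset ι)}
    (hsub : ∀ X ∈ F, X ⊆ T) (hE : ∀ X ∈ E, X ⊆ T) (hF : ∀ X ∈ F, X.card ≤ 1 ∨ X ∈ E) :
    fwt q F ≤ 1 + ∑ i ∈ T, q i + fwt q E := by
  rw [← fwt_lev_one]
  apply fwt_le_union hq _ _ hE
  · intro X hX
    rw [mem_union, mem_lev]
    rcases hF X hX with h | h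
    · exact Or.inl ⟨hsub X hX, h⟩
    · exact Or.inr h
  · intro X hX; exact (mem_lev.1 hX).1

theorem edge1_le {q : ι → ℝ} {T : Finset ι} (hq : ∀ i ∈ T, 2 ≤ q i) {a b : ι} (hab : a ≠ b)
    (ha : a ∈ T) (hb : b ∈ T) (E : Finset (Finset ι)) :
    fwt q (insert {a,b} E) ≤ fwt q E + q a * q b := by
  have := fwt_insert_le hq (H := E) {a,b} (by simp [insert_subset_iff, ha, hb])
  rwa [prod_pair hab] at this

theorem edge0_eq {q : ι → ℝ} {a b : ι} (hab : a ≠ b) :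
    fwt q {{a,b}} = q a * q b := by
  simp [fwt, prod_pair hab]

theorem Cfg.caseT1 {q : ι → ℝ} {T : Finset ι} {F G : Finset (Finset ι)}
    (h : Cfg q T 3 F G) {a b : ι} (hab : a ≠ b) (habF : {a, b} ∈ F)
    (hF : ∀ X ∈ F, X.card ≤ 1 ∨ X = {a, b}) (hG : ∀ X ∈ G, X.card ≤ 2) (hle : q b ≤ q a) :
    False := by
  have haT : a ∈ T := h.subF _ habF (by simp)
  have hbT : b ∈ T := h.subF _ habF (by simp)
  have hqa := h.hq a haT
  have hqb := h.hq b hbT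
  have hsum := sum2 q hab haT hbT
  have c2 := card_pair hab
  have ht : 2 ≤ ∑ i ∈ T \ {a,b}, q i := tau_ge h.hq (by have := h.hT; omega)
  have b0 := h.symm.sect_bd (U := {a,b}) (Y := ∅) habF (by simp) (by simp) 1 (by simp) (by simp [c2])
  have b1 := h.symm.sect_bd (U := {a,b}) (Y := {a}) habF (by simp) (by simp) 1 (by simp)
    (by rw [show ({a} ∪ {a,b} : Finset ι) = {a,b} by grind, c2])
  have b2 := h.symm.sect_bd (U := {a,b}) (Y := {b}) habF (by simp) (by simp) 1 (by simp)
    (by rw [show ({b} ∪ {a,b} : Finset ι) = {a,b} by grind, c2])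
  have b3 : fwt q (sect G (T \ {a,b}) {a,b}) ≤ _ := sect_le h.hq 0 (by simp) (by
    intro X hX hXY
    have h1 := hG _ hXY
    rw [card_union_of_disjoint (disjoint_of_subset_left hX sdiff_disjoint), c2] at h1
    omega)
  have eG := bd2 hab h.subG hqa hqb b0 b1 b2 b3
  have eF := edge_bd h.hq (E := {{a,b}}) h.subF (by simp [insert_subset_iff, haT, hbT])
    (by simpa using hF)
  rw [edge0_eq hab, hsum] at eF
  have hst := h.star_le' haT _ (by rw [hsum, add_assoc])
  have key := ineq_T1 (q a) (q b) _ hqb hle ht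
  have : fwt q F * fwt q G ≤ _ := mul_le_mul eF eG h.T2.2 (by positivity)
  simp only [lvb, mul_one] at this
  exact absurd (hst.trans this) (not_le.2 key)

theorem Cfg.caseT2 {q : ι → ℝ} {T : Finset ι} {F G : Finset (Finset ι)}
    (h : Cfg q T 3 F G) {a b c : ι} (hab : a ≠ b) (hac : a ≠ c) (hbc : b ≠ c)
    (habF : {a, b} ∈ F) (hacF : {a, c} ∈ F)
    (hF : ∀ X ∈ F, X.card ≤ 1 ∨ X = {a, b} ∨ X = {a, c}) (hG : ∀ X ∈ G, X.card ≤ 2) :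
    False := by
  have haT : a ∈ T := h.subF _ habF (by simp)
  have hbT : b ∈ T := h.subF _ habF (by simp)
  have hcT : c ∈ T := h.subF _ hacF (by simp)
  have hqa := h.hq a haT
  have hqb := h.hq b hbT
  have hqc := h.hq c hcT
  have hsum := sum3 q hab hac hbc haT hbT hcT
  have c2 := card_pair hab
  have c3 : ({a,b,c} : Finset ι).card = 3 := card_eq_three.2 ⟨a,b,c,hab,hac,hbc,rfl⟩
  have ht : 2 ≤ ∑ i ∈ T \ {a,b,c}, q i := tau_ge h.hq (by have := h.hT; omega)
  have sab : ({a,b} : Finset ι) ⊆ {a,b,c} := by simp [insert_subset_iff]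
  have sac : ({a,c} : Finset ι) ⊆ {a,b,c} := by simp [insert_subset_iff]
  have b0 := h.symm.sect_bd (U := {a,b,c}) (Y := ∅) habF sab (by simp) 1 (by simp) (by simp [c2])
  have b1 := h.symm.sect_bd (U := {a,b,c}) (Y := {a}) habF sab (by simp) 1 (by simp)
    (by rw [show ({a} ∪ {a,b} : Finset ι) = {a,b} by grind, c2])
  have b2 := h.symm.sect_bd (U := {a,b,c}) (Y := {b}) hacF sac (by simp) 0 (by simp)
    (by rw [show ({b} ∪ {a,c} : Finset ι) = {a,b,c} by grind, c3])
  have b3 := h.symm.sect_bd (U := {a,b,c}) (Y := {c}) habF sab (by simp) 0 (by simp)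
    (by rw [show ({c} ∪ {a,b} : Finset ι) = {a,b,c} by grind, c3])
  have b4 := h.symm.sect_bd (U := {a,b,c}) (Y := {a,b}) hacF sac (by simp [insert_subset_iff]) 0 (by simp)
    (by rw [show ({a,b} ∪ {a,c} : Finset ι) = {a,b,c} by grind, c3])
  have b5 := h.symm.sect_bd (U := {a,b,c}) (Y := {a,c}) habF sab (by simp [insert_subset_iff]) 0 (by simp)
    (by rw [show ({a,c} ∪ {a,b} : Finset ι) = {a,b,c} by grind, c3])
  have b6 := h.symm.sect_bd (U := {a,b,c}) (Y := {b,c}) habF sab (by simp [insert_subset_iff]) 0 (by simp)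
    (by rw [show ({b,c} ∪ {a,b} : Finset ι) = {a,b,c} by grind, c3])
  have b7 : fwt q (sect G (T \ {a,b,c}) {a,b,c}) ≤ 0 := by
    have : sect G (T \ {a,b,c}) {a,b,c} = ∅ := by
      rw [eq_empty_iff_forall_notMem]
      intro X hX
      rw [mem_sect] at hX
      have h1 := hG _ hX.2
      have h2 := card_le_card (subset_union_right (s₁ := X) (s₂ := {a,b,c}))
      omega
    rw [this, fwt_empty]
  have eG := bd3 hab hac hbc h.subG hqa hqb hqc b0 b1 b2 b3 b4 b5 b6 b7
  have eF := edge_bd h.hq (E := {{a,b},{a,c}}) h.subF (by simp [insert_subset_iff, haT, hbT, hcT])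
    (by simpa using hF)
  have e1 := edge1_le h.hq hab haT hbT {{a,c}}
  rw [edge0_eq hac] at e1
  rw [hsum] at eF
  have eF' : fwt q F ≤ (1+(q a+q b+q c+∑ i ∈ T \ {a,b,c}, q i)+q a*q b+q a*q c) := by linarith
  have hst := h.star_le' haT (q b + q c + ∑ i ∈ T \ {a,b,c}, q i) (by rw [hsum]; ring)
  have hpw := h.pow3_le hab hac hbc haT hbT hcT
  have : fwt q F * fwt q G ≤ _ := mul_le_mul eF' eG h.T2.2 (by positivity)
  simp only [lvb, mul_one, mul_zero, add_zero] at this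
  exact ineq_T2 (q a) (q b) (q c) _ hqa hqb hqc ht (hst.trans this) (hpw.trans this)

theorem Cfg.caseT3 {q : ι → ℝ} {T : Finset ι} {F G : Finset (Finset ι)}
    (h : Cfg q T 3 F G) {a b c : ι} (hab : a ≠ b) (hac : a ≠ c) (hbc : b ≠ c)
    (haT : a ∈ T) (hbT : b ∈ T) (hcT : c ∈ T)
    (hF : ∀ X ∈ F, X.card ≤ 1 ∨ X = {a, b} ∨ X = {a, c} ∨ X = {b, c})
    (hG : ∀ X ∈ G, X.card ≤ 1 ∨ X = {a, b} ∨ X = {a, c} ∨ X = {b, c}) :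
    False := by
  have hqa := h.hq a haT
  have hqb := h.hq b hbT
  have hqc := h.hq c hcT
  have hsum := sum3 q hab hac hbc haT hbT hcT
  have c3 : ({a,b,c} : Finset ι).card = 3 := card_eq_three.2 ⟨a,b,c,hab,hac,hbc,rfl⟩
  have ht : 2 ≤ ∑ i ∈ T \ {a,b,c}, q i := tau_ge h.hq (by have := h.hT; omega)
  have eF := edge_bd h.hq (E := {{a,b},{a,c},{b,c}}) h.subF (by simp [insert_subset_iff, haT, hbT, hcT])
    (by simpa using hF)
  have eG := edge_bd h.hq (E := {{a,b},{a,c},{b,c}}) h.subG (by simp [insert_subset_iff, haT, hbT, hcT])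
    (by simpa using hG)
  have e1 := edge1_le h.hq hab haT hbT {{a,c},{b,c}}
  have e2 := edge1_le h.hq hac haT hcT {{b,c}}
  rw [edge0_eq hbc] at e2
  rw [hsum] at eF eG
  have eF' : fwt q F ≤ (1+(q a+q b+q c+∑ i ∈ T \ {a,b,c}, q i)+q a*q b+q a*q c+q b*q c) := by linarith
  have eG' : fwt q G ≤ (1+(q a+q b+q c+∑ i ∈ T \ {a,b,c}, q i)+q a*q b+q a*q c+q b*q c) := by linarith
  have hst := h.star_le' haT (q b + q c + ∑ i ∈ T \ {a,b,c}, q i) (by rw [hsum]; ring)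
  have hpw := h.pow3_le hab hac hbc haT hbT hcT
  have := mul_le_mul eF' eG' h.T2.2 (by positivity)
  exact ineq_T3 (q a) (q b) (q c) _ hqa hqb hqc ht (hst.trans this) (hpw.trans this)

theorem Cfg.caseT4' {q : ι → ℝ} {T : Finset ι} {F G : Finset (Finset ι)}
    (h : Cfg q T 3 F G) {a b c d : ι} (hab : a ≠ b) (hac : a ≠ c) (had : a ≠ d) (hbc : b ≠ c)
    (hbd : b ≠ d) (hcd : c ≠ d)
    (haT : a ∈ T) (hbT : b ∈ T) (hcT : c ∈ T) (hdT : d ∈ T)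
    (hF : ∀ X ∈ F, X.card ≤ 1 ∨ X = {a, b} ∨ X = {c, d})
    (hG : ∀ X ∈ G, X.card ≤ 1 ∨ X = {a, c} ∨ X = {a, d} ∨ X = {b, c} ∨ X = {b, d})
    (h1 : q b ≤ q a) (h2 : q c ≤ q a) (h3 : q d ≤ q a) :
    False := by
  have hqa := h.hq a haT
  have hqb := h.hq b hbT
  have hqc := h.hq c hcT
  have hqd := h.hq d hdT
  have hsum := sum4 q hab hac had hbc hbd hcd haT hbT hcT hdT
  have ht : 0 ≤ ∑ i ∈ T \ {a,b,c,d}, q i := tau_nonneg h.hq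
  have eF := edge_bd h.hq (E := {{a,b},{c,d}}) h.subF (by simp [insert_subset_iff, haT, hbT, hcT, hdT])
    (by simpa using hF)
  have eG := edge_bd h.hq (E := {{a,c},{a,d},{b,c},{b,d}}) h.subG
    (by simp [insert_subset_iff, haT, hbT, hcT, hdT]) (by simpa using hG)
  have e1 := edge1_le h.hq hab haT hbT {{c,d}}
  rw [edge0_eq hcd] at e1
  have e2 := edge1_le h.hq hac haT hcT {{a,d},{b,c},{b,d}}
  have e3 := edge1_le h.hq had haT hdT {{b,c},{b,d}}
  have e4 := edge1_le h.hq hbc hbT hcT {{b,d}}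
  rw [edge0_eq hbd] at e4
  rw [hsum] at eF eG
  have eF' : fwt q F ≤ (1+(q a+q b+q c+q d+∑ i ∈ T \ {a,b,c,d}, q i)+q a*q b+q c*q d) := by linarith
  have eG' : fwt q G ≤ (1+(q a+q b+q c+q d+∑ i ∈ T \ {a,b,c,d}, q i)+q a*q c+q a*q d+q b*q c+q b*q d) := by
    linarith
  have hst := h.star_le' haT (q b + q c + q d + ∑ i ∈ T \ {a,b,c,d}, q i) (by rw [hsum]; ring)
  have := mul_le_mul eF' eG' h.T2.2 (by positivity)
  exact absurd (hst.trans this) (not_le.2 (ineq_T4 (q a) (q b) (q c) (q d) _ hqb hqc hqd h1 h2 h3 ht))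

theorem Cfg.caseT4 {q : ι → ℝ} {T : Finset ι} {F G : Finset (Finset ι)}
    (h : Cfg q T 3 F G) {a b c d : ι} (hab : a ≠ b) (hac : a ≠ c) (had : a ≠ d) (hbc : b ≠ c)
    (hbd : b ≠ d) (hcd : c ≠ d)
    (haT : a ∈ T) (hbT : b ∈ T) (hcT : c ∈ T) (hdT : d ∈ T)
    (hF : ∀ X ∈ F, X.card ≤ 1 ∨ X = {a, b} ∨ X = {c, d})
    (hG : ∀ X ∈ G, X.card ≤ 1 ∨ X = {a, c} ∨ X = {a, d} ∨ X = {b, c} ∨ X = {b, d}) :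
    False := by
  have hF2 : ∀ X ∈ F, X.card ≤ 1 ∨ X = {b, a} ∨ X = {c, d} := by
    simpa only [pair_comm b a] using hF
  have hF3 : ∀ X ∈ F, X.card ≤ 1 ∨ X = {c, d} ∨ X = {a, b} := by
    intro X hX; have := hF X hX; tauto
  have hF4 : ∀ X ∈ F, X.card ≤ 1 ∨ X = {d, c} ∨ X = {a, b} := by
    simpa only [pair_comm d c] using hF3
  have hG2 : ∀ X ∈ G, X.card ≤ 1 ∨ X = {b, c} ∨ X = {b, d} ∨ X = {a, c} ∨ X = {a, d} := by
    intro X hX; have := hG X hX; tauto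
  have hG3 : ∀ X ∈ G, X.card ≤ 1 ∨ X = {c, a} ∨ X = {c, b} ∨ X = {d, a} ∨ X = {d, b} := by
    intro X hX; have := hG X hX
    rw [pair_comm c a, pair_comm c b, pair_comm d a, pair_comm d b]; tauto
  have hG4 : ∀ X ∈ G, X.card ≤ 1 ∨ X = {d, a} ∨ X = {d, b} ∨ X = {c, a} ∨ X = {c, b} := by
    intro X hX; have := hG3 X hX; tauto
  by_cases m1 : q b ≤ q a ∧ q c ≤ q a ∧ q d ≤ q a
  · exact h.caseT4' hab hac had hbc hbd hcd haT hbT hcT hdT hF hG m1.1 m1.2.1 m1.2.2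
  by_cases m2 : q a ≤ q b ∧ q c ≤ q b ∧ q d ≤ q b
  · exact h.caseT4' hab.symm hbc hbd hac had hcd hbT haT hcT hdT hF2 hG2 m2.1 m2.2.1 m2.2.2
  by_cases m3 : q d ≤ q c ∧ q a ≤ q c ∧ q b ≤ q c
  · exact h.caseT4' hcd hac.symm hbc.symm had.symm hbd.symm hab hcT hdT haT hbT hF3 hG3
      m3.1 m3.2.1 m3.2.2
  by_cases m4 : q c ≤ q d ∧ q a ≤ q d ∧ q b ≤ q d
  · exact h.caseT4' hcd.symm had.symm hbd.symm hac.symm hbc.symm hab hdT hcT haT hbT hF4 hG4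
      m4.1 m4.2.1 m4.2.2
  grind

theorem Cfg.caseT5' {q : ι → ℝ} {T : Finset ι} {F G : Finset (Finset ι)}
    (h : Cfg q T 3 F G) {a b c d : ι} (hab : a ≠ b) (hac : a ≠ c) (had : a ≠ d) (hbc : b ≠ c)
    (hbd : b ≠ d) (hcd : c ≠ d)
    (haT : a ∈ T) (hbT : b ∈ T) (hcT : c ∈ T) (hdT : d ∈ T)
    (hF : ∀ X ∈ F, X.card ≤ 1 ∨ X = {a, b} ∨ X = {b, c} ∨ X = {c, d})
    (hG : ∀ X ∈ G, X.card ≤ 1 ∨ X = {a, c} ∨ X = {b, c} ∨ X = {b, d})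
    (h1 : q c ≤ q b) :
    False := by
  have hqa := h.hq a haT
  have hqb := h.hq b hbT
  have hqc := h.hq c hcT
  have hqd := h.hq d hdT
  have hsum := sum4 q hab hac had hbc hbd hcd haT hbT hcT hdT
  have ht : 0 ≤ ∑ i ∈ T \ {a,b,c,d}, q i := tau_nonneg h.hq
  have ht2 : ∑ i ∈ T \ {a,b,c,d}, q i = 0 ∨ 2 ≤ ∑ i ∈ T \ {a,b,c,d}, q i := tau_zero_or h.hq
  have eF := edge_bd h.hq (E := {{a,b},{b,c},{c,d}}) h.subF (by simp [insert_subset_iff, haT, hbT, hcT, hdT])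
    (by simpa using hF)
  have eG := edge_bd h.hq (E := {{a,c},{b,c},{b,d}}) h.subG
    (by simp [insert_subset_iff, haT, hbT, hcT, hdT]) (by simpa using hG)
  have e1 := edge1_le h.hq hab haT hbT {{b,c},{c,d}}
  have e2 := edge1_le h.hq hbc hbT hcT {{c,d}}
  rw [edge0_eq hcd] at e2
  have e3 := edge1_le h.hq hac haT hcT {{b,c},{b,d}}
  have e4 := edge1_le h.hq hbc hbT hcT {{b,d}}
  rw [edge0_eq hbd] at e4
  rw [hsum] at eF eG
  have eF' : fwt q F ≤ (1+(q a+q b+q c+q d+∑ i ∈ T \ {a,b,c,d}, q i)+q a*q b+q b*q c+q c*q d) := by linarith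
  have eG' : fwt q G ≤ (1+(q a+q b+q c+q d+∑ i ∈ T \ {a,b,c,d}, q i)+q a*q c+q b*q c+q b*q d) := by
    linarith
  have hst := h.star_le' hbT (q a + q c + q d + ∑ i ∈ T \ {a,b,c,d}, q i) (by rw [hsum]; ring)
  have hp1 := h.pow3_le hab.symm hbc hac hbT haT hcT
  have hp2 := h.pow3_le hbc hbd hcd hbT hcT hdT
  have := mul_le_mul eF' eG' h.T2.2 (by positivity)
  exact ineq_T5 (q a) (q b) (q c) (q d) _ hqa hqc hqd h1 ht ht2 (hst.trans this) (hp1.trans this)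
    (hp2.trans this)

theorem Cfg.caseT5 {q : ι → ℝ} {T : Finset ι} {F G : Finset (Finset ι)}
    (h : Cfg q T 3 F G) {a b c d : ι} (hab : a ≠ b) (hac : a ≠ c) (had : a ≠ d) (hbc : b ≠ c)
    (hbd : b ≠ d) (hcd : c ≠ d)
    (haT : a ∈ T) (hbT : b ∈ T) (hcT : c ∈ T) (hdT : d ∈ T)
    (hF : ∀ X ∈ F, X.card ≤ 1 ∨ X = {a, b} ∨ X = {b, c} ∨ X = {c, d})
    (hG : ∀ X ∈ G, X.card ≤ 1 ∨ X = {a, c} ∨ X = {b, c} ∨ X = {b, d}) :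
    False := by
  rcases le_total (q c) (q b) with h1 | h1
  · exact h.caseT5' hab hac had hbc hbd hcd haT hbT hcT hdT hF hG h1
  · refine h.symm.caseT5' hac hab had hbc.symm hcd hbd haT hcT hbT hdT ?_ ?_ h1
    · intro X hX; have := hG X hX; rw [pair_comm c b]; tauto
    · intro X hX; have := hF X hX; rw [pair_comm c b]; tauto

end core

section core
variable {ι : Type*} [DecidableEq ι]
set_option linter.unusedSectionVars false

theorem Cfg.dual_lev {q : ι → ℝ} {T : Finset ι} {t k : ℕ} {F G : Finset (Finset ι)}
    (h : Cfg q T t F G) (hk : k ≤ t) (hG : G = lev T k) : F = lev T (t - k) := by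
  ext X
  rw [mem_lev]
  constructor
  · intro hX
    refine ⟨h.subF X hX, ?_⟩
    by_contra hc
    have hXT := h.subF X hX
    have hcard := card_sdiff_add_card_eq_card hXT
    have hT := h.hT
    obtain ⟨Y, hY1, hY2⟩ := exists_subset_card_eq (s := T \ X) (n := t + 1 - X.card) (by omega)
    have hYG : Y ∈ G := by
      rw [hG, mem_lev]
      exact ⟨hY1.trans sdiff_subset, by omega⟩
    have h1 := h.cross X hX Y hYG
    rw [card_union_of_disjoint (disjoint_of_subset_right hY1 disjoint_sdiff)] at h1
    omega
  · rintro ⟨h1, h2⟩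
    apply h.dualF X h1
    intro Y hY
    rw [hG, mem_lev] at hY
    have := card_union_le X Y
    omega

theorem Cfg.both_of {q : ι → ℝ} {T : Finset ι} {t k : ℕ} {F G : Finset (Finset ι)}
    (h : Cfg q T t F G) (hk : k ≤ t) (hG : G = lev T k) :
    (∃ k, F = lev T k) ∧ (∃ k, G = lev T k) := ⟨⟨_, h.dual_lev hk hG⟩, ⟨_, hG⟩⟩

theorem sub3 {Y : Finset ι} {a b c : ι} (h : Y ⊆ {a, b, c}) :
    Y = ∅ ∨ Y = {a} ∨ Y = {b} ∨ Y = {c} ∨ Y = {a,b} ∨ Y = {a,c} ∨ Y = {b,c} ∨ Y = {a,b,c} := by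
  have h' : ∀ i ∈ Y, i = a ∨ i = b ∨ i = c := fun i hi => by simpa using h hi
  by_cases ha : a ∈ Y <;> by_cases hb : b ∈ Y <;> by_cases hc : c ∈ Y
  · right; right; right; right; right; right; right; grind
  · right; right; right; right; left; grind
  · right; right; right; right; right; left; grind
  · right; left; grind
  · right; right; right; right; right; right; left; grind
  · right; right; left; grind
  · right; right; right; left; grind
  · left; grind

theorem Cfg.caseG1w {q : ι → ℝ} {T : Finset ι} {F G : Finset (Finset ι)}
    (h : Cfg q T 3 F G) {a b : ι} (hab : a ≠ b) (ha : {a} ∈ G) (hb : {b} ∈ G)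
    (hG : ∀ Y ∈ G, Y = ∅ ∨ Y = {a} ∨ Y = {b}) : False := by
  rcases le_total (q b) (q a) with h1 | h1
  · exact h.caseG1 hab ha hb (fun Y hY => by simpa using hG Y hY) h1
  · exact h.caseG1 hab.symm hb ha (fun Y hY => by have := hG Y hY; simp; tauto) h1

theorem Cfg.caseG2w {q : ι → ℝ} {T : Finset ι} {F G : Finset (Finset ι)}
    (h : Cfg q T 3 F G) {a b c : ι} (hab : a ≠ b) (hac : a ≠ c) (hbc : b ≠ c)
    (ha : {a} ∈ G) (hb : {b} ∈ G) (hc : {c} ∈ G)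
    (hG : ∀ Y ∈ G, Y = ∅ ∨ Y = {a} ∨ Y = {b} ∨ Y = {c}) : False := by
  by_cases m1 : q b ≤ q a ∧ q c ≤ q a
  · exact h.caseG2 hab hac hbc ha hb hc (fun Y hY => by simpa using hG Y hY) m1.1 m1.2
  by_cases m2 : q a ≤ q b ∧ q c ≤ q b
  · exact h.caseG2 hab.symm hbc hac hb ha hc
      (fun Y hY => by have := hG Y hY; simp; tauto) m2.1 m2.2
  by_cases m3 : q a ≤ q c ∧ q b ≤ q c
  · exact h.caseG2 hac.symm hbc.symm hab hc ha hb
      (fun Y hY => by have := hG Y hY; simp; tauto) m3.1 m3.2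
  grind

theorem Cfg.caseG3w {q : ι → ℝ} {T : Finset ι} {F G : Finset (Finset ι)}
    (h : Cfg q T 3 F G) {a b c : ι} (hab : a ≠ b) (hac : a ≠ c) (hbc : b ≠ c)
    (hc : {c} ∈ G) (habG : {a, b} ∈ G)
    (hG : ∀ Y ∈ G, Y = ∅ ∨ Y = {a} ∨ Y = {b} ∨ Y = {c} ∨ Y = {a, b}) : False := by
  rcases le_total (q b) (q a) with h1 | h1
  · exact h.caseG3 hab hac hbc hc habG (fun Y hY => by simpa using hG Y hY) h1
  · exact h.caseG3 hab.symm hbc hac hc (by rwa [pair_comm])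
      (fun Y hY => by have := hG Y hY; rw [pair_comm b a]; simp; tauto) h1

theorem Cfg.caseA {q : ι → ℝ} {T : Finset ι} {F G : Finset (Finset ι)}
    (h : Cfg q T 3 F G) {Z : Finset ι} (hZ : Z ∈ F) (hc : Z.card = 3) : G = lev T 0 := by
  obtain ⟨a, b, c, hab, hac, hbc, rfl⟩ := card_eq_three.1 hc
  have hsub : ∀ Y ∈ G, Y ⊆ {a,b,c} := by
    intro Y hY
    have h1 := h.cross _ hZ _ hY
    have h2 := eq_of_subset_of_card_le (subset_union_left (s₁ := {a,b,c}) (s₂ := Y)) (by omega)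
    rw [h2]; exact subset_union_right
  have hm : ∀ Y ∈ G, _ := fun Y hY => sub3 (hsub Y hY)
  have haT : a ∈ T := h.subF _ hZ (by simp)
  have hbT : b ∈ T := h.subF _ hZ (by simp)
  have hcT : c ∈ T := h.subF _ hZ (by simp)
  have ra : ¬ ∀ X ∈ G, insert a X ∈ G := by
    obtain ⟨X, h1, h2⟩ := h.relG a haT; exact fun hh => h2 (hh X h1)
  have rb : ¬ ∀ X ∈ G, insert b X ∈ G := by
    obtain ⟨X, h1, h2⟩ := h.relG b hbT; exact fun hh => h2 (hh X h1)
  have rc : ¬ ∀ X ∈ G, insert c X ∈ G := by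
    obtain ⟨X, h1, h2⟩ := h.relG c hcT; exact fun hh => h2 (hh X h1)
  have dn := h.downG
  have em := h.emG
  have d1 : {a,b} ∈ G → {a} ∈ G ∧ {b} ∈ G := fun hx => ⟨dn _ hx _ (by simp), dn _ hx _ (by simp)⟩
  have d2 : {a,c} ∈ G → {a} ∈ G ∧ {c} ∈ G := fun hx => ⟨dn _ hx _ (by simp), dn _ hx _ (by simp)⟩
  have d3 : {b,c} ∈ G → {b} ∈ G ∧ {c} ∈ G := fun hx => ⟨dn _ hx _ (by simp), dn _ hx _ (by simp)⟩
  have d4 : {a,b,c} ∈ G → {a,b} ∈ G ∧ {a,c} ∈ G ∧ {b,c} ∈ G := fun hx =>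
    ⟨dn _ hx _ (by simp [insert_subset_iff]), dn _ hx _ (by simp [insert_subset_iff]),
      dn _ hx _ (by simp [insert_subset_iff])⟩
  have pa : {a} ∈ G → ({b} ∈ G → {a,b} ∈ G) → ({c} ∈ G → {a,c} ∈ G) →
      ({b,c} ∈ G → {a,b,c} ∈ G) → False := by
    intro k1 k2 k3 k4
    apply ra
    intro X hX
    rcases hm X hX with rfl | rfl | rfl | rfl | rfl | rfl | rfl | rfl
    · simpa using k1
    · simpa using k1
    · exact k2 hX
    · exact k3 hX
    · simpa using hX
    · simpa using hX
    · exact k4 hX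
    · simpa using hX
  have pb : {b} ∈ G → ({a} ∈ G → {a,b} ∈ G) → ({c} ∈ G → {b,c} ∈ G) →
      ({a,c} ∈ G → {a,b,c} ∈ G) → False := by
    intro k1 k2 k3 k4
    apply rb
    intro X hX
    rcases hm X hX with rfl | rfl | rfl | rfl | rfl | rfl | rfl | rfl
    · simpa using k1
    · rw [pair_comm]; exact k2 hX
    · simpa using k1
    · exact k3 hX
    · simpa using hX
    · rw [insert_comm]; exact k4 hX
    · simpa using hX
    · simpa using hX
  have pc : {c} ∈ G → ({a} ∈ G → {a,c} ∈ G) → ({b} ∈ G → {b,c} ∈ G) →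
      ({a,b} ∈ G → {a,b,c} ∈ G) → False := by
    intro k1 k2 k3 k4
    apply rc
    intro X hX
    rcases hm X hX with rfl | rfl | rfl | rfl | rfl | rfl | rfl | rfl
    · simpa using k1
    · rw [pair_comm]; exact k2 hX
    · rw [pair_comm]; exact k3 hX
    · simpa using k1
    · rw [insert_comm, pair_comm c b]; exact k4 hX
    · simpa using hX
    · simpa using hX
    · simpa using hX
  clear ra rb rc
  have hm' : ∀ Y ∈ G, Y = ∅ ∨ (Y = {a} ∧ {a} ∈ G) ∨ (Y = {b} ∧ {b} ∈ G) ∨ (Y = {c} ∧ {c} ∈ G) ∨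
      (Y = {a,b} ∧ {a,b} ∈ G) ∨ (Y = {a,c} ∧ {a,c} ∈ G) ∨ (Y = {b,c} ∧ {b,c} ∈ G) ∨
      (Y = {a,b,c} ∧ {a,b,c} ∈ G) := by
    intro Y hY
    rcases hm Y hY with rfl | rfl | rfl | rfl | rfl | rfl | rfl | rfl <;> simp [hY]
  by_cases A : {a} ∈ G <;> by_cases B : {b} ∈ G <;> by_cases C : {c} ∈ G
  · by_cases AB : {a,b} ∈ G <;> by_cases AC : {a,c} ∈ G <;> by_cases BC : {b,c} ∈ G
    · exfalso
      by_cases ABC : {a,b,c} ∈ G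
      · exact pa A (fun _ => AB) (fun _ => AC) (fun _ => ABC)
      · exact h.caseG5 hab hac hbc AB AC BC
          (fun Y hY => by have hh := hm' Y hY; clear * - hh ABC; simp; tauto)
    · exact (pa A (fun _ => AB) (fun _ => AC) (fun hh => absurd hh BC)).elim
    · exact (pb B (fun _ => AB) (fun _ => BC) (fun hh => absurd hh AC)).elim
    · have ABC : {a,b,c} ∉ G := fun hh => AC (d4 hh).2.1
      exact (h.caseG3w hab hac hbc C AB (fun Y hY => by have hh := hm' Y hY; clear * - hh AC BC ABC; tauto)).elim
    · exact (pc C (fun _ => AC) (fun _ => BC) (fun hh => absurd hh AB)).elim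
    · have ABC : {a,b,c} ∉ G := fun hh => AB (d4 hh).1
      exact (h.caseG3w hac hab hbc.symm B AC (fun Y hY => by have hh := hm' Y hY; clear * - hh AB BC ABC; tauto)).elim
    · have ABC : {a,b,c} ∉ G := fun hh => AB (d4 hh).1
      exact (h.caseG3w hbc hab.symm hac.symm A BC (fun Y hY => by have hh := hm' Y hY; clear * - hh AB AC ABC; tauto)).elim
    · have ABC : {a,b,c} ∉ G := fun hh => AB (d4 hh).1
      exact (h.caseG2w hab hac hbc A B C (fun Y hY => by have hh := hm' Y hY; clear * - hh AB AC BC ABC; tauto)).elim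
  · have AC : {a,c} ∉ G := fun hh => C (d2 hh).2
    have BC : {b,c} ∉ G := fun hh => C (d3 hh).2
    have ABC : {a,b,c} ∉ G := fun hh => BC (d4 hh).2.2
    by_cases AB : {a,b} ∈ G
    · exact (pa A (fun _ => AB) (fun hh => absurd hh C) (fun hh => absurd hh BC)).elim
    · exact (h.caseG1w hab A B (fun Y hY => by have hh := hm' Y hY; clear * - hh C AB AC BC ABC; tauto)).elim
  · have AB : {a,b} ∉ G := fun hh => B (d1 hh).2
    have BC : {b,c} ∉ G := fun hh => B (d3 hh).1
    have ABC : {a,b,c} ∉ G := fun hh => BC (d4 hh).2.2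
    by_cases AC : {a,c} ∈ G
    · exact (pa A (fun hh => absurd hh B) (fun _ => AC) (fun hh => absurd hh BC)).elim
    · exact (h.caseG1w hac A C (fun Y hY => by have hh := hm' Y hY; clear * - hh B AB AC BC ABC; tauto)).elim
  · exact (pa A (fun hh => absurd hh B) (fun hh => absurd hh C) (fun hh => absurd (d3 hh).1 B)).elim
  · have AB : {a,b} ∉ G := fun hh => A (d1 hh).1
    have AC : {a,c} ∉ G := fun hh => A (d2 hh).1
    have ABC : {a,b,c} ∉ G := fun hh => AC (d4 hh).2.1
    by_cases BC : {b,c} ∈ G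
    · exact (pb B (fun hh => absurd hh A) (fun _ => BC) (fun hh => absurd hh AC)).elim
    · exact (h.caseG1w hbc B C (fun Y hY => by have hh := hm' Y hY; clear * - hh A AB AC BC ABC; tauto)).elim
  · exact (pb B (fun hh => absurd hh A) (fun hh => absurd hh C) (fun hh => absurd (d2 hh).1 A)).elim
  · exact (pc C (fun hh => absurd hh A) (fun hh => absurd hh B) (fun hh => absurd (d1 hh).1 A)).elim
  · ext Y
    rw [mem_lev]
    constructor
    · intro hY
      have : Y = ∅ := by
        rcases hm Y hY with e | e | e | e | e | e | e | e
        · exact e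
        · exact absurd (e ▸ hY) A
        · exact absurd (e ▸ hY) B
        · exact absurd (e ▸ hY) C
        · exact absurd (d1 (e ▸ hY)).1 A
        · exact absurd (d2 (e ▸ hY)).1 A
        · exact absurd (d3 (e ▸ hY)).1 B
        · exact absurd (d1 (d4 (e ▸ hY)).1).1 A
      subst this; simp
    · rintro ⟨_, h2⟩
      have : Y = ∅ := card_eq_zero.1 (by omega)
      subst this; exact em

theorem pair_eq {Y : Finset ι} (hY : Y.card = 2) {u v : ι} (hu : u ∈ Y) (hv : v ∈ Y) (huv : u ≠ v) :
    Y = {u, v} := by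
  refine (eq_of_subset_of_card_le ?_ ?_).symm
  · simp [insert_subset_iff, hu, hv]
  · rw [card_pair huv, hY]

/-- two pairs in cross families meet -/
theorem meet_of {X Y : Finset ι} {a b : ι} (hX : X = {a, b}) (h : ¬ Disjoint X Y) :
    a ∈ Y ∨ b ∈ Y := by
  subst hX
  by_contra hc
  apply h
  rw [disjoint_left]; grind

theorem Cfg.meets {q : ι → ℝ} {T : Finset ι} {F G : Finset (Finset ι)}
    (h : Cfg q T 3 F G) {a b : ι} (hab : a ≠ b) (hX : {a,b} ∈ F) :
    ∀ Y ∈ G, Y.card = 2 → a ∈ Y ∨ b ∈ Y := by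
  intro Y hY hc
  by_contra hn
  have := h.cross _ hX _ hY
  rw [card_union_of_disjoint (by rw [disjoint_left]; grind), card_pair hab, hc] at this
  omega

theorem Cfg.caseT1w {q : ι → ℝ} {T : Finset ι} {F G : Finset (Finset ι)}
    (h : Cfg q T 3 F G) {a b : ι} (hab : a ≠ b) (habF : {a, b} ∈ F)
    (hF2 : ∀ X ∈ F, X.card ≤ 2) (hG : ∀ X ∈ G, X.card ≤ 2)
    (hF : ∀ X ∈ F, X.card = 2 → X = {a, b}) : False := by
  have hF' : ∀ X ∈ F, X.card ≤ 1 ∨ X = {a,b} := by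
    intro X hX
    have h1 := hF2 X hX
    by_cases h2 : X.card = 2
    · exact Or.inr (hF X hX h2)
    · left; omega
  rcases le_total (q b) (q a) with h1 | h1
  · exact h.caseT1 hab habF hF' hG h1
  · exact h.caseT1 hab.symm (by rwa [pair_comm]) (by rwa [pair_comm]) hG h1

theorem cover4 {Y : Finset ι} (hY : Y.card = 2) {a b c d : ι} (hac : a ≠ c) (had : a ≠ d)
    (hbc : b ≠ c) (hbd : b ≠ d) (h1 : a ∈ Y ∨ b ∈ Y) (h2 : c ∈ Y ∨ d ∈ Y) :
    Y = {a,c} ∨ Y = {a,d} ∨ Y = {b,c} ∨ Y = {b,d} := by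
  rcases h1 with h1 | h1 <;> rcases h2 with h2 | h2
  · exact Or.inl (pair_eq hY h1 h2 hac)
  · exact Or.inr (Or.inl (pair_eq hY h1 h2 had))
  · exact Or.inr (Or.inr (Or.inl (pair_eq hY h1 h2 hbc)))
  · exact Or.inr (Or.inr (Or.inr (pair_eq hY h1 h2 hbd)))

theorem Cfg.caseD1 {q : ι → ℝ} {T : Finset ι} {F G : Finset (Finset ι)}
    (h : Cfg q T 3 F G) (hF2 : ∀ X ∈ F, X.card ≤ 2) (hG2 : ∀ X ∈ G, X.card ≤ 2)
    {a b c d : ι} (hab : a ≠ b) (hac : a ≠ c) (had : a ≠ d) (hbc : b ≠ c)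
    (hbd : b ≠ d) (hcd : c ≠ d) (h1 : {a,b} ∈ F) (h2 : {c,d} ∈ F) (h3 : {a,c} ∈ G)
    (h4 : {b,d} ∈ G) : False := by
  have haT : a ∈ T := h.subF _ h1 (by simp)
  have hbT : b ∈ T := h.subF _ h1 (by simp)
  have hcT : c ∈ T := h.subF _ h2 (by simp)
  have hdT : d ∈ T := h.subF _ h2 (by simp)
  have eG : ∀ Y ∈ G, Y.card ≤ 1 ∨ (Y = {a,c} ∨ (Y = {a,d} ∧ {a,d} ∈ G) ∨ (Y = {b,c} ∧ {b,c} ∈ G) ∨ Y = {b,d}) := by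
    intro Y hY
    have := hG2 Y hY
    by_cases hc : Y.card = 2
    · right
      rcases cover4 hc hac had hbc hbd (h.meets hab h1 Y hY hc) (h.meets hcd h2 Y hY hc) with
        rfl | rfl | rfl | rfl <;> simp [hY]
    · left; omega
  have eF : ∀ Y ∈ F, Y.card ≤ 1 ∨ (Y = {a,b} ∨ (Y = {a,d} ∧ {a,d} ∈ F) ∨ (Y = {b,c} ∧ {b,c} ∈ F) ∨ Y = {c,d}) := by
    intro Y hY
    have := hF2 Y hY
    by_cases hc : Y.card = 2
    · right
      rcases cover4 hc hab had hbc.symm hcd (h.symm.meets hac h3 Y hY hc) (h.symm.meets hbd h4 Y hY hc) with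
        rfl | rfl | rfl | rfl
      · simp
      · simp [hY]
      · rw [pair_comm] at hY; rw [pair_comm]; simp [hY]
      · simp
    · left; omega
  have x1 : {a,d} ∈ F → {b,c} ∉ G := fun u v => by
    have := h.meets had u _ v (card_pair hbc); grind
  have x2 : {b,c} ∈ F → {a,d} ∉ G := fun u v => by
    have := h.meets hbc u _ v (card_pair had); grind
  by_cases f1 : {a,d} ∈ F <;> by_cases f2 : {b,c} ∈ F
  · refine h.symm.caseT4 hac hab had hbc.symm hcd hbd haT hcT hbT hdT ?_ ?_
    · intro Y hY; have hh := eG Y hY; have y1 := x1; have y2 := x2; clear * - hh f1 f2 y1 y2; tauto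
    · intro Y hY; have hh := eF Y hY; clear * - hh f1 f2; rw [pair_comm c b]; tauto
  · refine h.caseT5 hab.symm hbd hbc had hac hcd.symm hbT haT hdT hcT ?_ ?_
    · intro Y hY; have hh := eF Y hY; clear * - hh f1 f2; rw [pair_comm b a, pair_comm d c]; tauto
    · intro Y hY; have hh := eG Y hY; have y1 := x1; have y2 := x2; clear * - hh f1 f2 y1 y2; tauto
  · refine h.caseT5 hab hac had hbc hbd hcd haT hbT hcT hdT ?_ ?_
    · intro Y hY; have hh := eF Y hY; clear * - hh f1 f2; tauto
    · intro Y hY; have hh := eG Y hY; have y1 := x1; have y2 := x2; clear * - hh f1 f2 y1 y2; tauto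
  · refine h.caseT4 hab hac had hbc hbd hcd haT hbT hcT hdT ?_ ?_
    · intro Y hY; have hh := eF Y hY; clear * - hh f1 f2; tauto
    · intro Y hY; have hh := eG Y hY; have y1 := x1; have y2 := x2; clear * - hh f1 f2 y1 y2; tauto

theorem Cfg.caseD {q : ι → ℝ} {T : Finset ι} {F G : Finset (Finset ι)}
    (h : Cfg q T 3 F G) (hF2 : ∀ X ∈ F, X.card ≤ 2) (hG2 : ∀ X ∈ G, X.card ≤ 2)
    (hne : ∃ Y ∈ G, Y.card = 2)
    {a b c d : ι} (hab : a ≠ b) (hac : a ≠ c) (had : a ≠ d) (hbc : b ≠ c)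
    (hbd : b ≠ d) (hcd : c ≠ d) (h1 : {a,b} ∈ F) (h2 : {c,d} ∈ F) : False := by
  have eG0 : ∀ Y ∈ G, Y.card = 2 → ((Y = {a,c} ∧ {a,c} ∈ G) ∨ (Y = {a,d} ∧ {a,d} ∈ G) ∨ (Y = {b,c} ∧ {b,c} ∈ G) ∨ (Y = {b,d} ∧ {b,d} ∈ G)) := by
    intro Y hY hc
    rcases cover4 hc hac had hbc hbd (h.meets hab h1 Y hY hc) (h.meets hcd h2 Y hY hc) with
        rfl | rfl | rfl | rfl <;> simp [hY]
  have eG : ∀ Y ∈ G, Y.card ≤ 1 ∨ ((Y = {a,c} ∧ {a,c} ∈ G) ∨ (Y = {a,d} ∧ {a,d} ∈ G) ∨ (Y = {b,c} ∧ {b,c} ∈ G) ∨ (Y = {b,d} ∧ {b,d} ∈ G)) := by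
    intro Y hY
    have := hG2 Y hY
    by_cases hc : Y.card = 2
    · right; exact eG0 Y hY hc
    · left; omega
  have n1 : ¬ ({a,c} ∈ G ∧ {b,d} ∈ G) := fun hh =>
    h.caseD1 hF2 hG2 hab hac had hbc hbd hcd h1 h2 hh.1 hh.2
  have n2 : ¬ ({a,d} ∈ G ∧ {b,c} ∈ G) := fun hh =>
    h.caseD1 hF2 hG2 hab had hac hbd hbc hcd.symm h1 (by rwa [pair_comm]) hh.1 hh.2
  have e0 : {a,c} ∈ G ∨ {a,d} ∈ G ∨ {b,c} ∈ G ∨ {b,d} ∈ G := by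
    obtain ⟨Y, hY, hc⟩ := hne
    have hh := eG0 Y hY hc; clear * - hh ; tauto
  by_cases m1 : {a,c} ∈ G
  · have nn1 : {b,d} ∉ G := fun hh => n1 ⟨m1, hh⟩
    by_cases m2 : {a,d} ∈ G
    · have nn2 : {b,c} ∉ G := fun hh => n2 ⟨m2, hh⟩
      exact h.symm.caseT2 hac had hcd m1 m2 (fun Y hY => by have hh := eG Y hY; clear * - hh nn1 nn2; tauto) hF2
    · by_cases m3 : {b,c} ∈ G
      · exact h.symm.caseT2 hac.symm hbc.symm hab (by rwa [pair_comm]) (by rwa [pair_comm])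
          (fun Y hY => by have hh := eG Y hY; clear * - hh nn1 m2; rw [pair_comm c a, pair_comm c b]; tauto) hF2
      · exact h.symm.caseT1w hac m1 hG2 hF2 (fun Y hY hc => by have hh := eG0 Y hY hc; clear * - hh nn1 m2 m3; tauto)
  · by_cases m2 : {a,d} ∈ G
    · have nn2 : {b,c} ∉ G := fun hh => n2 ⟨m2, hh⟩
      by_cases m3 : {b,d} ∈ G
      · exact h.symm.caseT2 had.symm hbd.symm hab (by rwa [pair_comm]) (by rwa [pair_comm])
          (fun Y hY => by have hh := eG Y hY; clear * - hh nn2 m1; rw [pair_comm d a, pair_comm d b]; tauto) hF2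
      · exact h.symm.caseT1w had m2 hG2 hF2 (fun Y hY hc => by have hh := eG0 Y hY hc; clear * - hh m1 nn2 m3; tauto)
    · by_cases m3 : {b,c} ∈ G
      · by_cases m4 : {b,d} ∈ G
        · exact h.symm.caseT2 hbc hbd hcd m3 m4 (fun Y hY => by have hh := eG Y hY; clear * - hh m1 m2; tauto) hF2
        · exact h.symm.caseT1w hbc m3 hG2 hF2 (fun Y hY hc => by have hh := eG0 Y hY hc; clear * - hh m1 m2 m4; tauto)
      · exact h.symm.caseT1w hbd (by clear * - e0 m1 m2 m3; tauto) hG2 hF2 (fun Y hY hc => by have hh := eG0 Y hY hc; clear * - hh m1 m2 m3; tauto)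

theorem Cfg.caseB {q : ι → ℝ} {T : Finset ι} {F G : Finset (Finset ι)}
    (h : Cfg q T 3 F G) (hF2 : ∀ X ∈ F, X.card ≤ 2) (hG2 : ∀ X ∈ G, X.card ≤ 2)
    (hnF : ∃ Y ∈ F, Y.card = 2) (hnG : ∃ Y ∈ G, Y.card = 2) : False := by
  obtain ⟨X, hX, hXc⟩ := hnF
  by_cases hu : ∀ Y ∈ F, Y.card = 2 → Y = X
  · obtain ⟨a, b, hab, rfl⟩ := card_eq_two.1 hXc
    exact h.caseT1w hab hX hF2 hG2 hu
  push Not at hu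
  obtain ⟨Y, hY, hYc, hXY⟩ := hu
  -- pairwise intersecting in `F`
  have hpair : ∀ a b, a ≠ b → {a,b} ∈ F → ∀ Z ∈ F, Z.card = 2 → a ∈ Z ∨ b ∈ Z := by
    intro a b hab hF Z hZ hZc
    by_contra hn
    push Not at hn
    obtain ⟨c, d, hcd, rfl⟩ := card_eq_two.1 hZc
    simp only [mem_insert, mem_singleton] at hn
    exact h.caseD hF2 hG2 hnG hab (by tauto) (by tauto) (by tauto) (by tauto) hcd hF hZ
  obtain ⟨a, b, c, hab, hac, hbc, h1, h2⟩ : ∃ a b c, a ≠ b ∧ a ≠ c ∧ b ≠ c ∧ {a,b} ∈ F ∧ {a,c} ∈ F := by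
    obtain ⟨a, b, hab, rfl⟩ := card_eq_two.1 hXc
    obtain ⟨c, d, hcd, rfl⟩ := card_eq_two.1 hYc
    have := hpair a b hab hX _ hY hYc
    simp only [mem_insert, mem_singleton] at this
    rcases this with (rfl | rfl) | (rfl | rfl)
    · exact ⟨a, b, d, hab, hcd, by rintro rfl; exact hXY rfl, hX, hY⟩
    · exact ⟨a, b, c, hab, hcd.symm, by rintro rfl; exact hXY (pair_comm _ _), hX, by rwa [pair_comm]⟩
    · exact ⟨b, a, d, hab.symm, hcd, by rintro rfl; exact hXY (pair_comm _ _), by rwa [pair_comm], hY⟩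
    · exact ⟨b, a, c, hab.symm, hcd.symm, by rintro rfl; exact hXY rfl, by rwa [pair_comm], by rwa [pair_comm]⟩
  clear hXY hYc hY hXc hX
  have haT : a ∈ T := h.subF _ h1 (by simp)
  have hbT : b ∈ T := h.subF _ h1 (by simp)
  have hcT : c ∈ T := h.subF _ h2 (by simp)
  by_cases hbcF : {b,c} ∈ F
  · have tri : ∀ Z : Finset ι, Z.card = 2 → (a ∈ Z ∨ b ∈ Z) → (a ∈ Z ∨ c ∈ Z) → (b ∈ Z ∨ c ∈ Z) →
        Z = {a,b} ∨ Z = {a,c} ∨ Z = {b,c} := by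
      intro Z hZ k1 k2 k3
      by_cases ka : a ∈ Z
      · rcases k3 with k | k
        · exact Or.inl (pair_eq hZ ka k hab)
        · exact Or.inr (Or.inl (pair_eq hZ ka k hac))
      · exact Or.inr (Or.inr (pair_eq hZ (by tauto) (by tauto) hbc))
    refine h.caseT3 hab hac hbc haT hbT hcT ?_ ?_
    · intro Z hZ
      have := hF2 Z hZ
      by_cases hc : Z.card = 2
      · right; exact tri Z hc (hpair a b hab h1 Z hZ hc) (hpair a c hac h2 Z hZ hc) (hpair b c hbc hbcF Z hZ hc)
      · left; omega
    · intro Z hZ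
      have := hG2 Z hZ
      by_cases hc : Z.card = 2
      · right; exact tri Z hc (h.meets hab h1 Z hZ hc) (h.meets hac h2 Z hZ hc) (h.meets hbc hbcF Z hZ hc)
      · left; omega
  by_cases hthird : ∀ Z ∈ F, Z.card = 2 → Z = {a,b} ∨ Z = {a,c}
  · refine h.caseT2 hab hac hbc h1 h2 ?_ hG2
    intro Z hZ
    have := hF2 Z hZ
    by_cases hc : Z.card = 2
    · right; exact hthird Z hZ hc
    · left; omega
  push Not at hthird
  obtain ⟨Z, hZ, hZc, hZ1, hZ2⟩ := hthird
  have haZ : a ∈ Z := by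
    by_contra hn
    have k1 := hpair a b hab h1 Z hZ hZc
    have k2 := hpair a c hac h2 Z hZ hZc
    have := pair_eq hZc (by tauto : b ∈ Z) (by tauto : c ∈ Z) hbc
    exact hbcF (this ▸ hZ)
  obtain ⟨d, hda, hZd⟩ : ∃ d, d ≠ a ∧ Z = {a,d} := by
    obtain ⟨d, hd, hda⟩ := exists_mem_ne (by omega : 1 < Z.card) a
    exact ⟨d, hda, pair_eq hZc haZ hd hda.symm⟩
  subst hZd
  have hdb : d ≠ b := by rintro rfl; exact hZ1 rfl
  have hdc : d ≠ c := by rintro rfl; exact hZ2 rfl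
  have star : ∀ W : Finset ι, W.card = 2 → (a ∈ W ∨ b ∈ W) → (a ∈ W ∨ c ∈ W) → (a ∈ W ∨ d ∈ W) →
      a ∈ W := by
    intro W hW k1 k2 k3
    by_contra hn
    have e := pair_eq hW (by tauto : b ∈ W) (by tauto : c ∈ W) hbc
    have kd : d ∈ W := by tauto
    rw [e] at kd
    simp at kd; tauto
  have sG : ∀ W ∈ G, W.card = 2 → a ∈ W := fun W hW hc =>
    star W hc (h.meets hab h1 W hW hc) (h.meets hac h2 W hW hc) (h.meets hda.symm hZ W hW hc)
  have sF : ∀ W ∈ F, W.card = 2 → a ∈ W := fun W hW hc =>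
    star W hc (hpair a b hab h1 W hW hc) (hpair a c hac h2 W hW hc) (hpair a d hda.symm hZ W hW hc)
  obtain ⟨W, hW, hWn⟩ := h.relF a haT
  by_cases hc : W.card = 2
  · rw [insert_eq_of_mem (sF W hW hc)] at hWn; exact hWn hW
  · have hW2 := hF2 W hW
    apply hWn
    apply h.dualF
    · exact insert_subset haT (h.subF W hW)
    · intro V hV
      have hV2 := hG2 V hV
      have hi := card_insert_le a W
      by_cases hVc : V.card = 2
      · have haV := sG V hV hVc
        rw [insert_union, insert_eq_of_mem (mem_union_right _ haV)]
        have := card_union_le W V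
        omega
      · have := card_union_le (insert a W) V
        omega

theorem Cfg.class3 {q : ι → ℝ} {T : Finset ι} {F G : Finset (Finset ι)}
    (h : Cfg q T 3 F G) : (∃ k, F = lev T k) ∧ (∃ k, G = lev T k) := by
  have hF3 : ∀ X ∈ F, X.card ≤ 3 := fun X hX => by simpa using h.cross X hX _ h.emG
  have hG3 : ∀ X ∈ G, X.card ≤ 3 := fun X hX => by simpa using h.symm.cross X hX _ h.emF
  by_cases kF : ∃ Z ∈ F, Z.card = 3
  · obtain ⟨Z, hZ, hc⟩ := kF
    exact h.both_of (by omega) (h.caseA hZ hc)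
  by_cases kG : ∃ Z ∈ G, Z.card = 3
  · obtain ⟨Z, hZ, hc⟩ := kG
    exact (h.symm.both_of (by omega) (h.symm.caseA hZ hc)).symm
  push Not at kF kG
  have hF2 : ∀ X ∈ F, X.card ≤ 2 := fun X hX => by have := hF3 X hX; have := kF X hX; omega
  have hG2 : ∀ X ∈ G, X.card ≤ 2 := fun X hX => by have := hG3 X hX; have := kG X hX; omega
  by_cases nG : ∃ Y ∈ G, Y.card = 2
  · by_cases nF : ∃ Y ∈ F, Y.card = 2
    · exact (h.caseB hF2 hG2 nF nG).elim
    · refine (h.symm.both_of (k := 1) (by omega) ?_).symm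
      push Not at nF
      ext X; rw [mem_lev]
      constructor
      · intro hX; exact ⟨h.subF X hX, by have := hF2 X hX; have := nF X hX; omega⟩
      · rintro ⟨h1, h2⟩
        apply h.dualF X h1
        intro Y hY
        have := hG2 Y hY; have := card_union_le X Y; omega
  · refine (h.both_of (k := 1) (by omega) ?_)
    push Not at nG
    ext X; rw [mem_lev]
    constructor
    · intro hX; exact ⟨h.subG X hX, by have := hG2 X hX; have := nG X hX; omega⟩
    · rintro ⟨h1, h2⟩
      apply h.dualG X h1
      intro Y hY
      have := hF2 Y hY; have := card_union_le Y X; omega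

theorem Cfg.class2A {q : ι → ℝ} {T : Finset ι} {F G : Finset (Finset ι)}
    (h : Cfg q T 2 F G) {Z : Finset ι} (hZ : Z ∈ F) (hc : Z.card = 2) : G = lev T 0 := by
  obtain ⟨a, b, hab, rfl⟩ := card_eq_two.1 hc
  have hsub : ∀ Y ∈ G, Y ⊆ {a,b} := by
    intro Y hY
    have h1 := h.cross _ hZ _ hY
    have h2 := eq_of_subset_of_card_le (subset_union_left (s₁ := {a,b}) (s₂ := Y)) (by omega)
    rw [h2]; exact subset_union_right
  have hm : ∀ Y ∈ G, Y = ∅ ∨ Y = {a} ∨ Y = {b} ∨ Y = {a,b} := by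
    intro Y hY
    have h' : ∀ i ∈ Y, i = a ∨ i = b := fun i hi => by simpa using hsub Y hY hi
    by_cases ha : a ∈ Y <;> by_cases hb : b ∈ Y
    · right; right; right; grind
    · right; left; grind
    · right; right; left; grind
    · left; grind
  have haT : a ∈ T := h.subF _ hZ (by simp)
  have hbT : b ∈ T := h.subF _ hZ (by simp)
  have hqa := h.hq a haT
  have hqb := h.hq b hbT
  have dn := h.downG
  have d1 : {a,b} ∈ G → {a} ∈ G ∧ {b} ∈ G := fun hx => ⟨dn _ hx _ (by simp), dn _ hx _ (by simp)⟩
  have pa : {a} ∈ G → ({b} ∈ G → {a,b} ∈ G) → False := by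
    intro k1 k2
    obtain ⟨X, hX, hn⟩ := h.relG a haT
    apply hn
    rcases hm X hX with rfl | rfl | rfl | rfl
    · simpa using k1
    · simpa using k1
    · exact k2 hX
    · simpa using hX
  have pb : {b} ∈ G → ({a} ∈ G → {a,b} ∈ G) → False := by
    intro k1 k2
    obtain ⟨X, hX, hn⟩ := h.relG b hbT
    apply hn
    rcases hm X hX with rfl | rfl | rfl | rfl
    · simpa using k1
    · rw [pair_comm]; exact k2 hX
    · simpa using k1
    · simpa using hX
  by_cases A : {a} ∈ G <;> by_cases B : {b} ∈ G
  · exfalso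
    have AB : {a,b} ∉ G := fun hh => pa A (fun _ => hh)
    have hsum := sum2 q hab haT hbT
    have ht : 2 ≤ ∑ i ∈ T \ {a,b}, q i := tau_ge h.hq (by have := h.hT; omega)
    have eG : fwt q G ≤ 1 + q a + q b := by
      have h1 := fwt_mono h.hq (F := G) (H := {∅,{a},{b}})
        (by
          intro Y hY
          rcases hm Y hY with rfl | rfl | rfl | rfl
          · simp
          · simp
          · simp
          · exact absurd hY AB) (by simp [haT, hbT])
      have h2 := fwt_insert_le h.hq (H := {{a},{b}}) ∅ (by simp)
      have h3 := fwt_insert_le h.hq (H := {{b}}) {a} (by simpa using haT)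
      have h4 := fwt_insert_le h.hq (H := ∅) {b} (by simpa using hbT)
      simp only [prod_singleton, prod_empty, fwt_empty, insert_empty_eq] at h2 h3 h4
      linarith
    have eF := edge_bd h.hq (E := {{a,b}}) h.subF (by simp [insert_subset_iff, haT, hbT]) (by
      intro X hX
      by_cases hXa : a ∈ X
      · by_cases hXb : b ∈ X
        · right
          have := h.cross X hX _ h.emG
          rw [union_empty] at this
          rw [mem_singleton]
          exact (eq_of_subset_of_card_le (by simp [insert_subset_iff, hXa, hXb]) (by omega)).symm
        · left
          have := h.cross X hX _ B
          rw [union_comm, ← insert_eq, card_insert_of_notMem hXb] at this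
          omega
      · left
        have := h.cross X hX _ A
        rw [union_comm, ← insert_eq, card_insert_of_notMem hXa] at this
        omega)
    rw [edge0_eq hab, hsum] at eF
    have m1 := h.mx (lev T 1) (fun X hX => (mem_lev.1 hX).1) (by
      intro X hX Y hY
      have := card_union_le X Y
      have := (mem_lev.1 hX).2
      have := (mem_lev.1 hY).2
      omega)
    rw [fwt_lev_one, hsum] at m1
    have m2 := h.pow_le (h.subF _ hZ) (by omega)
    rw [prod_pair hab] at m2
    have : fwt q F * fwt q G ≤ _ := mul_le_mul eF eG h.T2.2 (by positivity)
    rw [mul_comm _ (1 + q a + q b)] at this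
    exact ineq_t2 (q a) (q b) _ hqa hqb ht (m1.trans this) (m2.trans this)
  · exact (pa A (fun hh => absurd hh B)).elim
  · exact (pb B (fun hh => absurd hh A)).elim
  · ext Y
    rw [mem_lev]
    constructor
    · intro hY
      have : Y = ∅ := by
        rcases hm Y hY with rfl | rfl | rfl | rfl
        · rfl
        · exact absurd hY A
        · exact absurd hY B
        · exact absurd (d1 hY).1 A
      subst this; simp
    · rintro ⟨_, h2⟩
      have : Y = ∅ := card_eq_zero.1 (by omega)
      subst this; exact h.emG

theorem Cfg.class2 {q : ι → ℝ} {T : Finset ι} {F G : Finset (Finset ι)}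
    (h : Cfg q T 2 F G) : (∃ k, F = lev T k) ∧ (∃ k, G = lev T k) := by
  have hF3 : ∀ X ∈ F, X.card ≤ 2 := fun X hX => by simpa using h.cross X hX _ h.emG
  have hG3 : ∀ X ∈ G, X.card ≤ 2 := fun X hX => by simpa using h.symm.cross X hX _ h.emF
  by_cases kF : ∃ Z ∈ F, Z.card = 2
  · obtain ⟨Z, hZ, hc⟩ := kF
    exact h.both_of (by omega) (h.class2A hZ hc)
  by_cases kG : ∃ Z ∈ G, Z.card = 2
  · obtain ⟨Z, hZ, hc⟩ := kG
    exact (h.symm.both_of (by omega) (h.symm.class2A hZ hc)).symm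
  push Not at kF kG
  have hF2 : ∀ X ∈ F, X.card ≤ 1 := fun X hX => by have := hF3 X hX; have := kF X hX; omega
  refine (h.both_of (k := 1) (by omega) ?_)
  ext X; rw [mem_lev]
  constructor
  · intro hX; exact ⟨h.subG X hX, by have := hG3 X hX; have := kG X hX; omega⟩
  · rintro ⟨h1, h2⟩
    apply h.dualG X h1
    intro Y hY
    have := hF2 Y hY; have := card_union_le Y X; omega

theorem Cfg.zero_of {q : ι → ℝ} {T : Finset ι} {t : ℕ} {F G : Finset (Finset ι)}
    (h : Cfg q T t F G) (hG : ∀ Y ∈ G, Y = ∅) : G = lev T 0 := by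
  ext Y; rw [mem_lev]
  constructor
  · intro hY; have := hG Y hY; subst this; simp
  · rintro ⟨_, h2⟩
    have : Y = ∅ := card_eq_zero.1 (by omega)
    subst this; exact h.emG

theorem Cfg.class1 {q : ι → ℝ} {T : Finset ι} {F G : Finset (Finset ι)}
    (h : Cfg q T 1 F G) : (∃ k, F = lev T k) ∧ (∃ k, G = lev T k) := by
  by_cases k : ∀ X ∈ F, X = ∅
  · exact (h.symm.both_of (by omega) (h.symm.zero_of k)).symm
  push Not at k
  obtain ⟨X, hX, hne⟩ := k
  have hXc := h.cross X hX _ h.emG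
  rw [union_empty] at hXc
  have hc : X.card = 1 := by have := hne.card_pos; omega
  obtain ⟨a, rfl⟩ := card_eq_one.1 hc
  have hm : ∀ Y ∈ G, Y ⊆ {a} := by
    intro Y hY
    have h1 := h.cross _ hX _ hY
    have h2 := eq_of_subset_of_card_le (subset_union_left (s₁ := {a}) (s₂ := Y)) (by omega)
    rw [h2]; exact subset_union_right
  refine h.both_of (k := 0) (by omega) (h.zero_of ?_)
  intro Y hY
  rcases subset_singleton_iff.1 (hm Y hY) with h1 | rfl
  · exact h1
  exfalso
  obtain ⟨W, hW, hn⟩ := h.relG a (h.subF _ hX (by simp))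
  rcases subset_singleton_iff.1 (hm W hW) with rfl | rfl
  · exact hn (by simpa using hY)
  · exact hn (by simpa using hY)

theorem Cfg.class0 {q : ι → ℝ} {T : Finset ι} {F G : Finset (Finset ι)}
    (h : Cfg q T 0 F G) : (∃ k, F = lev T k) ∧ (∃ k, G = lev T k) := by
  refine h.both_of (k := 0) (by omega) (h.zero_of ?_)
  intro Y hY
  have := h.cross _ h.emF Y hY
  rw [empty_union] at this
  exact card_eq_zero.1 (by omega)

theorem Cfg.classify {q : ι → ℝ} {T : Finset ι} {t : ℕ} {F G : Finset (Finset ι)}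
    (h : Cfg q T t F G) (ht : t ≤ 3) : (∃ k, F = lev T k) ∧ (∃ k, G = lev T k) := by
  interval_cases t
  · exact h.class0
  · exact h.class1
  · exact h.class2
  · exact h.class3

end core

section coord
variable {n : ℕ} {p : Fin n → ℕ}
open scoped Classical

/-- values allowed in coordinate `i` -/
noncomputable def nbr (A : Finset (∀ j, Fin (p j))) (i : Fin n) (x : ∀ j, Fin (p j)) :
    Finset (Fin (p i)) := univ.filter (fun m => Function.update x i m ∈ A)

theorem mem_nbr {A : Finset (∀ j, Fin (p j))} {i : Fin n} {x : ∀ j, Fin (p j)} {m : Fin (p i)} :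
    m ∈ nbr A i x ↔ Function.update x i m ∈ A := by simp [nbr]

theorem nbr_update (A : Finset (∀ j, Fin (p j))) (i : Fin n) (x : ∀ j, Fin (p j)) (m : Fin (p i)) :
    nbr A i (Function.update x i m) = nbr A i x := by
  ext k; simp [mem_nbr]

/-- filter with a fixed decidability instance -/
noncomputable def nf {P : ℕ} (Φ : Fin P → Prop) : Finset (Fin P) := univ.filter Φ

theorem mem_nf {P : ℕ} {Φ : Fin P → Prop} {k : Fin P} : k ∈ nf Φ ↔ Φ k := by simp [nf]

theorem nf_true {P : ℕ} {Φ : Fin P → Prop} (h : ∀ k, Φ k) : nf Φ = univ := by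
  ext k; simp [mem_nf, h]

theorem nf_false {P : ℕ} {Φ : Fin P → Prop} (h : ∀ k, ¬ Φ k) : nf Φ = ∅ := by
  ext k; simp [mem_nf, h]

theorem cnt_nbr (A : Finset (∀ j, Fin (p j))) (i : Fin n) :
    p i * A.card = ∑ x, (nbr A i x).card := by
  let e : ((∀ j, Fin (p j)) × Fin (p i)) ≃ ((∀ j, Fin (p j)) × Fin (p i)) :=
    { toFun := fun P => (Function.update P.1 i P.2, P.1 i)
      invFun := fun P => (Function.update P.1 i P.2, P.1 i)
      left_inv := by rintro ⟨x, m⟩; simp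
      right_inv := by rintro ⟨x, m⟩; simp }
  have h1 : ∑ x, (nbr A i x).card = ∑ P : (∀ j, Fin (p j)) × Fin (p i), if (e P).1 ∈ A then 1 else 0 := by
    rw [Fintype.sum_prod_type]
    apply sum_congr rfl
    intro x _
    simp only [nbr, card_filter, e]
    rfl
  rw [h1, Equiv.sum_comp e (fun P => if P.1 ∈ A then 1 else 0), Fintype.sum_prod_type]
  have h2 : ∑ x : (∀ j, Fin (p j)), (if x ∈ A then 1 else 0) = A.card := by simp
  rw [sum_comm]
  simp only [h2]
  simp

/-- a family derived from `A` -/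
noncomputable def newset (A : Finset (∀ j, Fin (p j))) (i : Fin n)
    (Φ : Finset (Fin (p i)) → Fin (p i) → Prop) : Finset (∀ j, Fin (p j)) :=
  univ.filter (fun x => Φ (nbr A i x) (x i))

theorem cnt_newset (A : Finset (∀ j, Fin (p j))) (i : Fin n)
    (Φ : Finset (Fin (p i)) → Fin (p i) → Prop) :
    p i * (newset A i Φ).card = ∑ x, (nf (Φ (nbr A i x))).card := by
  rw [cnt_nbr]
  apply sum_congr rfl
  intro x _
  congr 1
  ext k
  simp [mem_nbr, newset, nbr_update, mem_nf]

theorem cross_newset {r : ℕ} {A B : Finset (∀ j, Fin (p j))} (h : CrossInt r A B) (i : Fin n)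
    (Φ Ψ : Finset (Fin (p i)) → Fin (p i) → Prop)
    (hc : ∀ S S' k k', Φ S k → Ψ S' k' → S.Nonempty → S'.Nonempty →
      ∃ m ∈ S, ∃ m' ∈ S', m = m' → k = k')
    (hΦ : ∀ k, ¬ Φ ∅ k) (hΨ : ∀ k, ¬ Ψ ∅ k) :
    CrossInt r (newset A i Φ) (newset B i Ψ) := by
  intro x hx y hy
  simp only [newset, mem_filter, mem_univ, true_and] at hx hy
  obtain ⟨m, hm, m', hm', hmm⟩ := hc _ _ _ _ hx hy
    (nonempty_iff_ne_empty.2 (fun h0 => hΦ _ (h0 ▸ hx)))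
    (nonempty_iff_ne_empty.2 (fun h0 => hΨ _ (h0 ▸ hy)))
  refine (h _ (mem_nbr.1 hm) _ (mem_nbr.1 hm')).trans (card_le_card ?_)
  intro j hj
  simp only [mem_filter, mem_univ, true_and] at hj ⊢
  by_cases hji : j = i
  · subst hji
    simp only [Function.update_self] at hj
    exact hmm hj
  · simpa [Function.update_of_ne hji] using hj

theorem MaxPair.symm {r : ℕ} {A B : Finset (∀ j, Fin (p j))} (h : MaxPair r A B) :
    MaxPair r B A := by
  have key : ∀ C D : Finset (∀ j, Fin (p j)), CrossInt r C D → CrossInt r D C := by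
    intro C D hc x hx y hy
    have := hc y hy x hx
    simpa only [eq_comm] using this
  refine ⟨key _ _ h.1, fun A' B' hc => ?_⟩
  have := h.2 B' A' (key _ _ hc)
  rw [mul_comm, mul_comm B.card]; exact this

theorem MaxPair.pos {r : ℕ} {A B : Finset (∀ j, Fin (p j))} (h : MaxPair r A B) (hrn : r ≤ n)
    (hp : ∀ i, 2 < p i) : 0 < A.card ∧ 0 < B.card := by
  let x : ∀ j, Fin (p j) := fun j => ⟨0, by have := hp j; omega⟩
  have := h.2 {x} {x} (by intro y hy z hz; simp only [mem_singleton] at hy hz; subst hy; subst hz; simpa using hrn)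
  simp only [card_singleton] at this
  constructor
  · by_contra hc
    have : A.card = 0 := by omega
    simp_all
  · by_contra hc
    have : B.card = 0 := by omega
    simp_all

theorem MaxPair.eq_of_le {r : ℕ} {A B A' B' : Finset (∀ j, Fin (p j))} (h : MaxPair r A B)
    (hrn : r ≤ n) (hp : ∀ i, 2 < p i) (hc : CrossInt r A' B') (hA : A.card ≤ A'.card) :
    B'.card ≤ B.card := by
  have h0 := h.pos hrn hp
  have h1 := h.2 A' B' hc
  by_contra hn
  push Not at hn
  have : A.card * B.card < A'.card * B'.card := by
    calc A.card * B.card < A.card * B'.card := Nat.mul_lt_mul_of_pos_left hn h0.1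
      _ ≤ _ := Nat.mul_le_mul_right _ hA
  omega

theorem sum_types {P : ℕ} {V : Type*} [Fintype V] (N : V → Finset (Fin P)) (hP : 2 < P)
    (hN : ∀ x, N x = ∅ ∨ (∃ m, N x = {m}) ∨ N x = univ) (g : Finset (Fin P) → ℕ) (hg : g ∅ = 0) :
    ∑ x, g (N x) = (univ.filter (fun x => N x = univ)).card * g univ
      + ∑ m, (univ.filter (fun x => N x = {m})).card * g {m} := by
  have hu : ∀ m : Fin P, ({m} : Finset (Fin P)) ≠ univ := by
    intro m h
    have := congrArg Finset.card h
    simp at this; omega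
  have he : (∅ : Finset (Fin P)) ≠ univ := by
    intro h
    have := congrArg Finset.card h
    simp at this; omega
  simp only [card_filter, sum_mul]
  rw [sum_comm, ← sum_add_distrib]
  apply sum_congr rfl
  intro x _
  rcases hN x with h | ⟨m, h⟩ | h
  · rw [h, hg, if_neg he, sum_eq_zero]
    · simp
    · intro m _; rw [if_neg (singleton_ne_empty m).symm, zero_mul]
  · rw [h, if_neg (hu m)]
    simp [singleton_inj]
  · rw [h, if_pos rfl, sum_eq_zero]
    · simp
    · intro m _; rw [if_neg (hu m).symm, zero_mul]

theorem step1 {r : ℕ} {A B : Finset (∀ j, Fin (p j))} (h : MaxPair r A B) (hrn : r ≤ n)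
    (hp : ∀ i, 2 < p i) (i : Fin n) :
    ∀ x, nbr A i x = ∅ ∨ (∃ m, nbr A i x = {m}) ∨ nbr A i x = univ := by
  have hP := hp i
  let z : Fin (p i) := ⟨0, by omega⟩
  let Φ : Finset (Fin (p i)) → Fin (p i) → Prop := fun S k => 2 ≤ S.card ∨ (S.card = 1 ∧ k = z)
  have hΦ0 : ∀ k, ¬ Φ ∅ k := by intro k; simp [Φ]
  have hcr : CrossInt r (newset A i Φ) (newset B i Φ) := by
    apply cross_newset h.1 i Φ Φ _ hΦ0 hΦ0
    intro S S' k k' h1 h2 hS hS'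
    rcases h1 with h1 | ⟨h1, hk⟩
    · obtain ⟨m', hm'⟩ := hS'
      obtain ⟨m, hm, hne⟩ := exists_mem_ne (by omega : 1 < S.card) m'
      exact ⟨m, hm, m', hm', fun h => absurd h hne⟩
    · rcases h2 with h2 | ⟨h2, hk'⟩
      · obtain ⟨m, hm⟩ := hS
        obtain ⟨m', hm', hne⟩ := exists_mem_ne (by omega : 1 < S'.card) m
        exact ⟨m, hm, m', hm', fun h => absurd h.symm hne⟩
      · obtain ⟨m, hm⟩ := hS
        obtain ⟨m', hm'⟩ := hS'
        exact ⟨m, hm, m', hm', fun _ => hk.trans hk'.symm⟩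
  have hcount : ∀ S : Finset (Fin (p i)), S.card ≤ (nf (Φ S)).card := by
    intro S
    by_cases h2 : 2 ≤ S.card
    · rw [nf_true (fun k => Or.inl h2)]
      exact card_le_card (subset_univ S)
    · by_cases h1 : S.card = 1
      · have : 0 < (nf (Φ S)).card := card_pos.2 ⟨z, mem_nf.2 (Or.inr ⟨h1, rfl⟩)⟩
        omega
      · omega
  have hle : ∀ C : Finset (∀ j, Fin (p j)), C.card ≤ (newset C i Φ).card := by
    intro C
    have h1 := cnt_nbr C i
    have h2 := cnt_newset C i Φ
    have h3 : ∑ x, (nbr C i x).card ≤ ∑ x, (nf (Φ (nbr C i x))).card :=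
      sum_le_sum (fun x _ => hcount _)
    rw [← h1, ← h2] at h3
    exact Nat.le_of_mul_le_mul_left h3 (by omega)
  have hA : (newset A i Φ).card = A.card :=
    le_antisymm (h.symm.eq_of_le hrn hp (by
      intro x hx y hy
      have := hcr y hy x hx
      simpa only [eq_comm] using this) (hle B)) (hle A)
  have hs : ∑ x, (nbr A i x).card = ∑ x, (nf (Φ (nbr A i x))).card := by
    rw [← cnt_nbr, ← cnt_newset, hA]
  rw [sum_eq_sum_iff_of_le (fun x _ => hcount _)] at hs
  intro x
  have hx := hs x (mem_univ x)
  by_cases h2 : 2 ≤ (nbr A i x).card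
  · right; right
    rw [nf_true (fun k => Or.inl h2)] at hx
    exact eq_of_subset_of_card_le (subset_univ _) hx.ge
  · by_cases h1 : (nbr A i x).card = 1
    · right; left; exact card_eq_one.1 h1
    · left; exact card_eq_zero.1 (by omega)

theorem arith_final (P a b q s : ℤ) (hP : 3 ≤ P) (ha : 0 < a) (hb : 0 < b) (hq : 0 ≤ q) (hs : 0 ≤ s)
    (hqa : P * q ≤ a) (hsb : P * s ≤ b)
    (h1 : (a + (P - 1) * q) * (b - s) ≤ a * b) (h2 : (a - q) * (b + (P - 1) * s) ≤ a * b) :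
    q = 0 ∧ s = 0 := by
  have e1 : (P - 2) * (q * b + s * a) ≤ 2 * (P - 1) * (q * s) := by nlinarith
  have e2 : 2 * P * (q * s) ≤ q * b + s * a := by nlinarith
  have n1 : 0 ≤ q * b := by positivity
  have n2 : 0 ≤ s * a := by positivity
  have e3 : P * ((P - 2) * (q * b + s * a)) ≤ (P - 1) * (q * b + s * a) := by
    calc P * ((P - 2) * (q * b + s * a)) ≤ P * (2 * (P - 1) * (q * s)) :=
          mul_le_mul_of_nonneg_left e1 (by omega)
      _ = (P - 1) * (2 * P * (q * s)) := by ring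
      _ ≤ _ := mul_le_mul_of_nonneg_left e2 (by omega)
  have e4 : q * b + s * a ≤ 0 := by
    have : (P * P - 3 * P + 1) * (q * b + s * a) ≤ 0 := by nlinarith
    have h5 : 1 ≤ P * P - 3 * P + 1 := by nlinarith
    nlinarith
  have z1 : q * b = 0 := by omega
  have z2 : s * a = 0 := by omega
  constructor
  · rcases mul_eq_zero.1 z1 with h | h
    · exact h
    · omega
  · rcases mul_eq_zero.1 z2 with h | h
    · exact h
    · omega

/-- number of `x` with prescribed values -/
noncomputable def cU (A : Finset (∀ j, Fin (p j))) (i : Fin n) : ℕ :=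
  (univ.filter (fun x => nbr A i x = univ)).card
/-- number of `x` with prescribed single value -/
noncomputable def cE (A : Finset (∀ j, Fin (p j))) (i : Fin n) (m : Fin (p i)) : ℕ :=
  (univ.filter (fun x => nbr A i x = {m})).card
/-- number of `x` with single value other than `l` -/
noncomputable def cQ (A : Finset (∀ j, Fin (p j))) (i : Fin n) (l : Fin (p i)) : ℕ :=
  ∑ m ∈ univ.erase l, cE A i m

theorem cnt_gen {A : Finset (∀ j, Fin (p j))} {i : Fin n} (hP : 2 < p i)
    (hN : ∀ x, nbr A i x = ∅ ∨ (∃ m, nbr A i x = {m}) ∨ nbr A i x = univ)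
    (Φ : Finset (Fin (p i)) → Fin (p i) → Prop) (hΦ : ∀ k, ¬ Φ ∅ k) (l : Fin (p i)) (u e q : ℕ)
    (hu : (nf (Φ univ)).card = u) (he : (nf (Φ {l})).card = e)
    (hq : ∀ m, m ≠ l → (nf (Φ {m})).card = q) :
    p i * (newset A i Φ).card = cU A i * u + cE A i l * e + cQ A i l * q := by
  rw [cnt_newset, sum_types _ hP hN (fun S => (nf (Φ S)).card) (by rw [nf_false hΦ]; rfl)]
  rw [← add_sum_erase _ _ (mem_univ l)]
  simp only [hu, he]
  rw [add_assoc]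
  congr 2
  rw [cQ, sum_mul]
  apply sum_congr rfl
  intro m hm
  rw [hq m (mem_erase.1 hm).1]; rfl

theorem cnt_self {A : Finset (∀ j, Fin (p j))} {i : Fin n} (hP : 2 < p i)
    (hN : ∀ x, nbr A i x = ∅ ∨ (∃ m, nbr A i x = {m}) ∨ nbr A i x = univ) (l : Fin (p i)) :
    p i * A.card = cU A i * p i + cE A i l + cQ A i l := by
  rw [cnt_nbr, sum_types _ hP hN (fun S => S.card) (by simp)]
  rw [← add_sum_erase _ _ (mem_univ l)]
  simp [cU, cE, cQ, add_assoc]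

theorem coord_lemma {r : ℕ} {A B : Finset (∀ j, Fin (p j))} (h : MaxPair r A B) (hrn : r ≤ n)
    (hp : ∀ i, 2 < p i) (i : Fin n) :
    ∃ l, (∀ x, nbr A i x = ∅ ∨ nbr A i x = {l} ∨ nbr A i x = univ) ∧
      (∀ x, nbr B i x = ∅ ∨ nbr B i x = {l} ∨ nbr B i x = univ) := by
  have hNA := step1 h hrn hp i
  have hNB := step1 h.symm hrn hp i
  have hP := hp i
  have hne : Nonempty (Fin (p i)) := ⟨⟨0, by omega⟩⟩
  obtain ⟨l, hl⟩ := exists_max_image (univ : Finset (Fin (p i))) (cE A i) univ_nonempty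
  have hmax := hl.2
  clear hl
  have hQle : cQ A i l + cE A i l ≤ p i * cE A i l := by
    have : cQ A i l ≤ ∑ m ∈ univ.erase l, cE A i l := sum_le_sum (fun m _ => hmax m (mem_univ m))
    rw [sum_const, card_erase_of_mem (mem_univ l), card_univ, Fintype.card_fin, smul_eq_mul] at this
    obtain ⟨k, hk⟩ : ∃ k, p i = k + 1 := ⟨p i - 1, by omega⟩
    rw [hk] at this ⊢
    rw [Nat.add_sub_cancel] at this
    rw [add_mul, one_mul]; omega
  -- selecting sets
  let Φ : Finset (Fin (p i)) → Finset (Fin (p i)) → Fin (p i) → Prop := fun S0 S _ => ∃ m ∈ S, m ∈ S0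
  have hΦ0 : ∀ S0 k, ¬ Φ S0 ∅ k := by intro S0 k; simp [Φ]
  have hcr : ∀ S0 S1 : Finset (Fin (p i)), (∀ m ∈ S0, m ∉ S1) →
      CrossInt r (newset A i (Φ S0)) (newset B i (Φ S1)) := by
    intro S0 S1 hd
    apply cross_newset h.1 i _ _ _ (hΦ0 _) (hΦ0 _)
    rintro S S' k k' ⟨m, hm, hm0⟩ ⟨m', hm', hm1⟩ _ _
    exact ⟨m, hm, m', hm', fun hh => absurd (hh ▸ hm1) (hd m hm0)⟩
  obtain ⟨l', hl'⟩ : ∃ l', l' ≠ l := by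
    obtain ⟨l', _, hl'⟩ := exists_mem_ne (s := (univ : Finset (Fin (p i)))) (by simp; omega) l
    exact ⟨l', hl'⟩
  have cΦ1 : ∀ C : Finset (∀ j, Fin (p j)),
      (∀ x, nbr C i x = ∅ ∨ (∃ m, nbr C i x = {m}) ∨ nbr C i x = univ) →
      p i * (newset C i (Φ {l})).card = cU C i * p i + cE C i l * p i + cQ C i l * 0 := by
    intro C hC
    refine cnt_gen hP hC _ (hΦ0 _) l _ _ _ ?_ ?_ ?_
    · rw [nf_true (fun k => by simp [Φ])]; simp
    · rw [nf_true (fun k => by simp [Φ])]; simp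
    · intro m hm; rw [nf_false (fun k => by simp [Φ, hm])]; simp
  have cΦ2 : ∀ C : Finset (∀ j, Fin (p j)),
      (∀ x, nbr C i x = ∅ ∨ (∃ m, nbr C i x = {m}) ∨ nbr C i x = univ) →
      p i * (newset C i (Φ (univ.erase l))).card = cU C i * p i + cE C i l * 0 + cQ C i l * p i := by
    intro C hC
    refine cnt_gen hP hC _ (hΦ0 _) l _ _ _ ?_ ?_ ?_
    · rw [nf_true (fun k => ⟨l', mem_univ _, by simp [hl']⟩)]; simp
    · rw [nf_false (fun k => by simp [Φ])]; simp
    · intro m hm; rw [nf_true (fun k => by simp [Φ, hm])]; simp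
  have sA := cnt_self hP hNA l
  have sB := cnt_self hP hNB l
  have hPpos : 0 < p i := by omega
  have q1 : p i * cQ B i l ≤ cE B i l + cQ B i l := by
    have hh := h.eq_of_le hrn hp (hcr {l} (univ.erase l) (by simp)) (by
      apply Nat.le_of_mul_le_mul_left _ hPpos
      rw [cΦ1 A hNA, sA]; rw [mul_comm (cE A i l)]; omega)
    have := Nat.mul_le_mul_left (p i) hh
    rw [cΦ2 B hNB, sB, mul_comm (cQ B i l)] at this
    omega
  have q2 : p i * cQ A i l ≤ cE A i l + cQ A i l := by
    have hx := hcr (univ.erase l) {l} (by simp)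
    have hy : CrossInt r (newset B i (Φ {l})) (newset A i (Φ (univ.erase l))) := by
      intro x hx' y hy'
      have := hx y hy' x hx'
      simpa only [eq_comm] using this
    have hh := h.symm.eq_of_le hrn hp hy (by
      apply Nat.le_of_mul_le_mul_left _ hPpos
      rw [cΦ1 B hNB, sB]
      have : cE B i l + cQ B i l ≤ cE B i l * p i := by nlinarith
      omega)
    have := Nat.mul_le_mul_left (p i) hh
    rw [cΦ2 A hNA, sA, mul_comm (cQ A i l)] at this
    omega
  -- final sets
  let Φ1 : Finset (Fin (p i)) → Fin (p i) → Prop := fun S k =>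
    S = univ ∨ (S = {l} ∧ k = l) ∨ (∃ m, m ≠ l ∧ S = {m})
  let Φ2 : Finset (Fin (p i)) → Fin (p i) → Prop := fun S k => S = univ ∨ (S = {l} ∧ k = l)
  have hu : ∀ m : Fin (p i), ({m} : Finset (Fin (p i))) ≠ univ := by
    intro m h
    have := congrArg Finset.card h
    simp at this; omega
  have he : (∅ : Finset (Fin (p i))) ≠ univ := by
    intro h
    have := congrArg Finset.card h
    simp at this; omega
  have h10 : ∀ k, ¬ Φ1 ∅ k := by
    rintro k (h | ⟨h, _⟩ | ⟨m, _, h⟩)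
    · exact he h
    · exact singleton_ne_empty l h.symm
    · exact singleton_ne_empty m h.symm
  have h20 : ∀ k, ¬ Φ2 ∅ k := by
    rintro k (h | ⟨h, _⟩)
    · exact he h
    · exact singleton_ne_empty l h.symm
  have other : ∀ m : Fin (p i), ∃ m', m' ≠ m := by
    intro m
    obtain ⟨l', _, hl'⟩ := exists_mem_ne (s := (univ : Finset (Fin (p i)))) (by simp; omega) m
    exact ⟨l', hl'⟩
  have c1 : ∀ C : Finset (∀ j, Fin (p j)),
      (∀ x, nbr C i x = ∅ ∨ (∃ m, nbr C i x = {m}) ∨ nbr C i x = univ) →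
      p i * (newset C i Φ1).card = cU C i * p i + cE C i l * 1 + cQ C i l * p i := by
    intro C hC
    refine cnt_gen hP hC _ h10 l _ _ _ ?_ ?_ ?_
    · rw [nf_true (fun k => Or.inl rfl)]; simp
    · have : nf (Φ1 {l}) = {l} := by
        ext k; simp only [Φ1, hu, mem_nf, true_and, mem_singleton, false_or]
        constructor
        · rintro (h | ⟨m, h1, h2⟩)
          · exact h
          · exact absurd (singleton_injective h2).symm h1
        · intro h; exact Or.inl h
      rw [this, card_singleton]
    · intro m hm
      rw [nf_true (fun k => Or.inr (Or.inr ⟨m, hm, rfl⟩))]; simp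
  have c2 : ∀ C : Finset (∀ j, Fin (p j)),
      (∀ x, nbr C i x = ∅ ∨ (∃ m, nbr C i x = {m}) ∨ nbr C i x = univ) →
      p i * (newset C i Φ2).card = cU C i * p i + cE C i l * 1 + cQ C i l * 0 := by
    intro C hC
    refine cnt_gen hP hC _ h20 l _ _ _ ?_ ?_ ?_
    · rw [nf_true (fun k => Or.inl rfl)]; simp
    · have : nf (Φ2 {l}) = {l} := by
        ext k; simp [Φ2, hu, mem_nf]
      rw [this, card_singleton]
    · intro m hm
      rw [nf_false]
      · simp
      · rintro k (h | ⟨h, _⟩)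
        · exact hu m h
        · exact hm (singleton_injective h)
  have hcond : ∀ S S' k k', Φ1 S k → Φ2 S' k' → S.Nonempty → S'.Nonempty →
      ∃ m ∈ S, ∃ m' ∈ S', m = m' → k = k' := by
    intro S S' k k' h1 h2 hS hS'
    rcases h1 with rfl | ⟨rfl, rfl⟩ | ⟨m, hm, rfl⟩
    · obtain ⟨m', hm'⟩ := hS'
      obtain ⟨m, hm⟩ := other m'
      exact ⟨m, mem_univ _, m', hm', fun hh => absurd hh hm⟩
    · rcases h2 with rfl | ⟨rfl, rfl⟩
      · obtain ⟨m, hm⟩ := other k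
        exact ⟨k, by simp, m, mem_univ _, fun hh => absurd hh.symm hm⟩
      · exact ⟨_, mem_singleton_self _, _, mem_singleton_self _, fun _ => rfl⟩
    · rcases h2 with rfl | ⟨rfl, rfl⟩
      · obtain ⟨m', hm'⟩ := other m
        exact ⟨m, by simp, m', mem_univ _, fun hh => absurd hh.symm hm'⟩
      · exact ⟨m, by simp, k', by simp, fun hh => absurd hh hm⟩
  have hcr1 := h.2 _ _ (cross_newset h.1 i Φ1 Φ2 hcond h10 h20)
  have hcr2 := h.2 _ _ (cross_newset h.1 i Φ2 Φ1 (by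
    intro S S' k k' h1 h2 hS hS'
    obtain ⟨m, hm, m', hm', hh⟩ := hcond S' S k' k h2 h1 hS' hS
    exact ⟨m', hm', m, hm, fun e => (hh e.symm).symm⟩) h20 h10)
  have hpos := h.pos hrn hp
  have c1A := c1 A hNA
  have c1B := c1 B hNB
  have c2A := c2 A hNA
  have c2B := c2 B hNB
  have fin : (cQ A i l : ℤ) = 0 ∧ (cQ B i l : ℤ) = 0 := by
    have g1 : (p i * (newset A i Φ1).card) * (p i * (newset B i Φ2).card) ≤
        (p i * A.card) * (p i * B.card) := by nlinarith [Nat.mul_le_mul_left (p i * p i) hcr1]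
    have g2 : (p i * (newset A i Φ2).card) * (p i * (newset B i Φ1).card) ≤
        (p i * A.card) * (p i * B.card) := by nlinarith [Nat.mul_le_mul_left (p i * p i) hcr2]
    have pA : 0 < p i * A.card := Nat.mul_pos hPpos hpos.1
    have pB : 0 < p i * B.card := Nat.mul_pos hPpos hpos.2
    have w1 : (p i * (newset A i Φ1).card : ℤ) = (p i * A.card) + ((p i) - 1) * (cQ A i l) := by
      have e1 : ((p i * (newset A i Φ1).card : ℕ) : ℤ) = _ := congrArg Nat.cast c1A
      have e2 : ((p i * A.card : ℕ) : ℤ) = _ := congrArg Nat.cast sA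
      push_cast at e1 e2; rw [e1, e2]; ring
    have w2 : (p i * (newset B i Φ1).card : ℤ) = (p i * B.card) + ((p i) - 1) * (cQ B i l) := by
      have e1 : ((p i * (newset B i Φ1).card : ℕ) : ℤ) = _ := congrArg Nat.cast c1B
      have e2 : ((p i * B.card : ℕ) : ℤ) = _ := congrArg Nat.cast sB
      push_cast at e1 e2; rw [e1, e2]; ring
    have w3 : (p i * (newset A i Φ2).card : ℤ) = (p i * A.card) - (cQ A i l) := by
      have e1 : ((p i * (newset A i Φ2).card : ℕ) : ℤ) = _ := congrArg Nat.cast c2A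
      have e2 : ((p i * A.card : ℕ) : ℤ) = _ := congrArg Nat.cast sA
      push_cast at e1 e2; rw [e1, e2]; ring
    have w4 : (p i * (newset B i Φ2).card : ℤ) = (p i * B.card) - (cQ B i l) := by
      have e1 : ((p i * (newset B i Φ2).card : ℕ) : ℤ) = _ := congrArg Nat.cast c2B
      have e2 : ((p i * B.card : ℕ) : ℤ) = _ := congrArg Nat.cast sB
      push_cast at e1 e2; rw [e1, e2]; ring
    refine arith_final (p i) (p i * A.card) (p i * B.card) _ _ (by exact_mod_cast hP) (by exact_mod_cast pA)
      (by exact_mod_cast pB) (by positivity) (by positivity) ?_ ?_ ?_ ?_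
    · have : p i * cQ A i l ≤ p i * A.card := by omega
      exact_mod_cast this
    · have : p i * cQ B i l ≤ p i * B.card := by omega
      exact_mod_cast this
    · rw [← w1, ← w4]; exact_mod_cast g1
    · rw [← w2, ← w3]; exact_mod_cast g2
  have concl : ∀ C : Finset (∀ j, Fin (p j)),
      (∀ x, nbr C i x = ∅ ∨ (∃ m, nbr C i x = {m}) ∨ nbr C i x = univ) → (cQ C i l : ℤ) = 0 →
      ∀ x, nbr C i x = ∅ ∨ nbr C i x = {l} ∨ nbr C i x = univ := by
    intro C hC hQ x
    rcases hC x with h | ⟨m, h⟩ | h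
    · exact Or.inl h
    · by_cases hm : m = l
      · subst hm; exact Or.inr (Or.inl h)
      · exfalso
        have hQ' : cQ C i l = 0 := by exact_mod_cast hQ
        rw [cQ, sum_eq_zero_iff] at hQ'
        have := hQ' m (by simp [hm])
        rw [cE, card_eq_zero, eq_empty_iff_forall_notMem] at this
        exact this x (by simpa using h)
    · exact Or.inr (Or.inr h)
  exact ⟨l, concl A hNA fin.1, concl B hNB fin.2⟩

end coord

section glue
variable {n : ℕ} {p : Fin n → ℕ}
open scoped Classical

/-- deviation set -/
noncomputable def Dv (T : Finset (Fin n)) (x0 x : ∀ j, Fin (p j)) : Finset (Fin n) :=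
  T.filter (fun i => x i ≠ x0 i)

theorem mem_Dv {T : Finset (Fin n)} {x0 x : ∀ j, Fin (p j)} {i : Fin n} :
    i ∈ Dv T x0 x ↔ i ∈ T ∧ x i ≠ x0 i := by simp [Dv]

theorem Dv_sub {T : Finset (Fin n)} {x0 x : ∀ j, Fin (p j)} : Dv T x0 x ⊆ T :=
  fun _ hi => (mem_Dv.1 hi).1

theorem mono_step {A : Finset (∀ j, Fin (p j))} {i : Fin n} {l : Fin (p i)}
    (h : ∀ x, nbr A i x = ∅ ∨ nbr A i x = {l} ∨ nbr A i x = univ)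
    {x : ∀ j, Fin (p j)} (hx : x ∈ A) (m : Fin (p i)) (hm : m = l ∨ x i ≠ l) :
    Function.update x i m ∈ A := by
  have h0 : x i ∈ nbr A i x := by rw [mem_nbr, Function.update_eq_self]; exact hx
  rw [← mem_nbr]
  rcases h x with h | h | h
  · rw [h] at h0; simp at h0
  · rw [h] at h0 ⊢
    rw [mem_singleton] at *
    rcases hm with hm | hm
    · exact hm
    · exact absurd h0 hm
  · rw [h]; simp

theorem irr_step {A : Finset (∀ j, Fin (p j))} {i : Fin n} (h : ¬ Relevant A i)
    {x : ∀ j, Fin (p j)} (hx : x ∈ A) (m : Fin (p i)) : Function.update x i m ∈ A := by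
  by_contra hc
  exact h ⟨x, _, fun j hj => (Function.update_of_ne hj _ _).symm, hx, hc⟩

theorem mono_all {A : Finset (∀ j, Fin (p j))} {T : Finset (Fin n)} {x0 : ∀ j, Fin (p j)}
    (hA : ∀ i x, nbr A i x = ∅ ∨ nbr A i x = {x0 i} ∨ nbr A i x = univ)
    (hT : ∀ i, i ∉ T → ¬ Relevant A i) {x y : ∀ j, Fin (p j)} (hx : x ∈ A)
    (hD : Dv T x0 y ⊆ Dv T x0 x) : y ∈ A := by
  have key : ∀ S : Finset (Fin n), (fun j => if j ∈ S then y j else x j) ∈ A := by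
    intro S
    induction S using Finset.induction_on with
    | empty => simpa using hx
    | insert a S ha ih =>
      have e : (fun j => if j ∈ insert a S then y j else x j)
          = Function.update (fun j => if j ∈ S then y j else x j) a (y a) := by
        funext j
        by_cases hj : j = a
        · subst hj; simp
        · simp [hj]
      rw [e]
      by_cases haT : a ∈ T
      · apply mono_step (hA a) ih
        by_cases hy : y a = x0 a
        · exact Or.inl hy
        · right
          have := (mem_Dv.1 (hD (mem_Dv.2 ⟨haT, hy⟩))).2
          simpa [ha] using this
      · exact irr_step (hT a haT) ih _
  simpa using key univ

theorem card_fiber (T X : Finset (Fin n)) (hX : X ⊆ T) (x0 : ∀ j, Fin (p j)) :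
    (univ.filter (fun x => Dv T x0 x = X)).card
      = (∏ i ∈ univ \ T, p i) * ∏ i ∈ X, (p i - 1) := by
  have e : univ.filter (fun x => Dv T x0 x = X) = Fintype.piFinset (fun i =>
      if i ∈ X then univ.erase (x0 i) else if i ∈ T then {x0 i} else univ) := by
    ext x
    simp only [mem_filter, mem_univ, true_and, Fintype.mem_piFinset]
    constructor
    · rintro rfl i
      by_cases hi : i ∈ T
      · by_cases hx : x i = x0 i <;> simp [mem_Dv, hi, hx]
      · simp [mem_Dv, hi]
    · intro h
      ext i
      have := h i
      rw [mem_Dv]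
      by_cases hi : i ∈ X
      · simpa [hi, hX hi] using this
      · by_cases hT : i ∈ T
        · simpa [hi, hT] using this
        · simp [hi, hT]
  rw [e, Fintype.card_piFinset]
  have h1 : ∀ i, (if i ∈ X then univ.erase (x0 i) else if i ∈ T then {x0 i} else univ).card
      = (if i ∈ univ \ T then p i else 1) * (if i ∈ X then p i - 1 else 1) := by
    intro i
    by_cases hi : i ∈ X
    · simp [hi, hX hi]
    · by_cases hT : i ∈ T <;> simp [hi, hT]
  rw [prod_congr rfl (fun i _ => h1 i), prod_mul_distrib, prod_ite_mem, prod_ite_mem, univ_inter,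
    univ_inter]

theorem card_fam (hp : ∀ i, 2 < p i) (T : Finset (Fin n)) (x0 : ∀ j, Fin (p j))
    (H : Finset (Finset (Fin n))) (hH : ∀ X ∈ H, X ⊆ T) :
    ((univ.filter (fun x => Dv T x0 x ∈ H)).card : ℝ)
      = (∏ i ∈ univ \ T, (p i : ℝ)) * fwt (fun i => (p i : ℝ) - 1) H := by
  have h1 : (univ.filter (fun x => Dv T x0 x ∈ H)).card
      = ∑ X ∈ H, (∏ i ∈ univ \ T, p i) * ∏ i ∈ X, (p i - 1) := by
    rw [card_eq_sum_card_fiberwise (f := Dv T x0) (t := H) (by intro x hx; simpa using hx)]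
    apply sum_congr rfl
    intro X hX
    rw [← card_fiber T X (hH X hX) x0]
    congr 1
    ext x
    simp only [mem_filter, mem_univ, true_and]
    constructor
    · exact fun h => h.2
    · intro h; exact ⟨h ▸ hX, h⟩
  rw [h1, ← mul_sum, fwt]
  push_cast
  congr 1
  apply sum_congr rfl
  intro X _
  apply prod_congr rfl
  intro i _
  have := hp i
  rw [Nat.cast_sub (by omega)]
  simp

theorem agree_ge (T : Finset (Fin n)) (x0 x y : ∀ j, Fin (p j)) :
    T.card ≤ (univ.filter (fun i => x i = y i)).card + (Dv T x0 x ∪ Dv T x0 y).card := by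
  refine (card_le_card ?_).trans (card_union_le _ _)
  intro i hi
  by_cases h1 : x i = x0 i
  · by_cases h2 : y i = x0 i
    · simp [h1, h2]
    · simp [mem_Dv, hi, h2]
  · simp [mem_Dv, hi, h1]

/-- test vector -/
noncomputable def tv (T : Finset (Fin n)) (x0 c : ∀ j, Fin (p j)) (X : Finset (Fin n)) :
    ∀ j, Fin (p j) := fun i => if i ∈ T then (if i ∈ X then c i else x0 i) else c i

theorem Dv_tv {T X : Finset (Fin n)} {x0 c : ∀ j, Fin (p j)} (hX : X ⊆ T)
    (hc : ∀ i, c i ≠ x0 i) : Dv T x0 (tv T x0 c X) = X := by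
  ext i
  rw [mem_Dv, tv]
  by_cases hi : i ∈ X
  · simp [hi, hX hi, hc]
  · by_cases hT : i ∈ T <;> simp [hi, hT]

theorem agree_tv {T X Y : Finset (Fin n)} {x0 c d : ∀ j, Fin (p j)} (hX : X ⊆ T) (hY : Y ⊆ T)
    (hc : ∀ i, c i ≠ x0 i) (hd : ∀ i, d i ≠ x0 i) (hcd : ∀ i, c i ≠ d i) :
    (univ.filter (fun i => tv T x0 c X i = tv T x0 d Y i)).card + (X ∪ Y).card ≤ T.card := by
  rw [← card_union_of_disjoint]
  · apply card_le_card
    intro i hi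
    rw [mem_union, mem_filter] at hi
    rcases hi with ⟨_, hi⟩ | hi
    · by_contra hT
      simp [tv, hT, hcd] at hi
    · exact union_subset hX hY hi
  · rw [disjoint_left]
    intro i hi hi2
    have hT := union_subset hX hY hi2
    rw [mem_filter] at hi
    have h2 := hi.2
    rw [mem_union] at hi2
    by_cases h3 : i ∈ X
    · by_cases h4 : i ∈ Y
      · simp [tv, hT, h3, h4, hcd] at h2
      · simp [tv, hT, h3, h4, hc] at h2
    · by_cases h4 : i ∈ Y
      · simp only [tv, hT, h3, h4, if_true, if_false] at h2
        exact hd i h2.symm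
      · tauto

theorem MaxPair.dual {r : ℕ} {A B : Finset (∀ j, Fin (p j))} (h : MaxPair r A B) (hrn : r ≤ n)
    (hp : ∀ i, 2 < p i) {x : ∀ j, Fin (p j)}
    (hx : ∀ y ∈ B, r ≤ (univ.filter (fun i => x i = y i)).card) : x ∈ A := by
  by_contra hc
  have h1 := h.2 (insert x A) B (by
    intro z hz y hy
    rcases mem_insert.1 hz with rfl | hz
    · exact hx y hy
    · exact h.1 z hz y hy)
  rw [card_insert_of_notMem hc] at h1
  have := (h.pos hrn hp).2
  nlinarith

theorem half {r : ℕ} {A B : Finset (∀ j, Fin (p j))} (h : MaxPair r A B) (hrn : r ≤ n)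
    (hp : ∀ i, 2 < p i) {T : Finset (Fin n)} {x0 c d : ∀ j, Fin (p j)}
    (hA : ∀ i x, nbr A i x = ∅ ∨ nbr A i x = {x0 i} ∨ nbr A i x = univ)
    (hTA : ∀ i, i ∉ T → ¬ Relevant A i)
    (hc : ∀ i, c i ≠ x0 i) (t : ℕ) (ht : T.card = r + t) :
    (∀ x, Dv T x0 x ∈ A.image (Dv T x0) ↔ x ∈ A) ∧
    (∀ X ∈ A.image (Dv T x0), X ⊆ T) ∧
    (∀ X ∈ A.image (Dv T x0), ∀ Y, Y ⊆ X → Y ∈ A.image (Dv T x0)) ∧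
    (∅ ∈ A.image (Dv T x0)) ∧
    (∀ X, X ⊆ T → (∀ Y ∈ B.image (Dv T x0), (X ∪ Y).card ≤ t) → X ∈ A.image (Dv T x0)) ∧
    (∀ a, Relevant A a → ∃ X ∈ A.image (Dv T x0), insert a X ∉ A.image (Dv T x0)) ∧
    (A = univ.filter (fun x => Dv T x0 x ∈ A.image (Dv T x0))) := by
  have hmem : ∀ x, Dv T x0 x ∈ A.image (Dv T x0) ↔ x ∈ A := by
    intro x
    constructor
    · intro hx
      obtain ⟨z, hz, hzx⟩ := mem_image.1 hx
      exact mono_all hA hTA hz hzx.ge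
    · exact fun hx => mem_image_of_mem _ hx
  have hsub : ∀ X ∈ A.image (Dv T x0), X ⊆ T := by
    intro X hX
    obtain ⟨z, hz, rfl⟩ := mem_image.1 hX
    exact Dv_sub
  have hdown : ∀ X ∈ A.image (Dv T x0), ∀ Y, Y ⊆ X → Y ∈ A.image (Dv T x0) := by
    intro X hX Y hY
    have hXT := hsub X hX
    obtain ⟨z, hz, rfl⟩ := mem_image.1 hX
    have e := Dv_tv (c := c) (x0 := x0) (hY.trans hXT) hc
    rw [← e, hmem]
    exact mono_all hA hTA hz (by rw [e]; exact hY)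
  refine ⟨hmem, hsub, hdown, ?_, ?_, ?_, ?_⟩
  · obtain ⟨z, hz⟩ := card_pos.1 (h.pos hrn hp).1
    exact hdown _ (mem_image_of_mem _ hz) _ (empty_subset _)
  · intro X hX hY
    have e := Dv_tv (c := c) (x0 := x0) hX hc
    rw [← e, hmem]
    apply h.dual hrn hp
    intro y hy
    have h1 := agree_ge T x0 (tv T x0 c X) y
    have h2 := hY _ (mem_image_of_mem _ hy)
    rw [e] at h1
    omega
  · rintro a ⟨x, y, hxy, hx, hy⟩
    refine ⟨_, mem_image_of_mem _ hx, fun hc' => hy ?_⟩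
    rw [← hmem]
    refine hdown _ hc' _ ?_
    intro j hj
    rw [mem_Dv] at hj
    by_cases hja : j = a
    · simp [hja]
    · rw [mem_insert, mem_Dv, hxy j hja]; exact Or.inr hj
  · ext x; simp only [mem_filter, mem_univ, true_and]; exact (hmem x).symm

theorem rel_transfer {T : Finset (Fin n)} {t : ℕ} {F G : Finset (Finset (Fin n))}
    (hsub : ∀ Y ∈ G, Y ⊆ T)
    (cross : ∀ X ∈ F, ∀ Y ∈ G, (X ∪ Y).card ≤ t)
    (dualG : ∀ Y, Y ⊆ T → (∀ X ∈ F, (X ∪ Y).card ≤ t) → Y ∈ G) {a : Fin n} (ha : a ∈ T)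
    (h : ∃ Y ∈ G, insert a Y ∉ G) : ∃ X ∈ F, insert a X ∉ F := by
  obtain ⟨Y, hY, hYa⟩ := h
  have : ¬ ∀ X ∈ F, (X ∪ insert a Y).card ≤ t := fun hc =>
    hYa (dualG _ (insert_subset ha (hsub Y hY)) hc)
  push Not at this
  obtain ⟨X, hX, hXY⟩ := this
  refine ⟨X, hX, fun hc => ?_⟩
  have := cross _ hc _ hY
  rw [insert_union] at this
  rw [union_insert] at hXY
  omega

theorem glue_main {r : ℕ} (hr : 1 ≤ r) (hrn : r ≤ n)
    (hp : ∀ i, 2 < p i)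
    {A B : Finset (∀ i, Fin (p i))} (h : MaxPair r A B) (T : Finset (Fin n))
    (hTdef : ∀ i, i ∈ T ↔ (Relevant A i ∨ Relevant B i)) (hcard : T.card ≤ r + 3) :
    IsBall A ∧ IsBall B := by
  choose x0 hA hB using fun i => coord_lemma h hrn hp i
  have hcd : ∀ i, ∃ c d : Fin (p i), c ≠ x0 i ∧ d ≠ x0 i ∧ c ≠ d := by
    intro i
    have h2 : 1 < ((univ : Finset (Fin (p i))).erase (x0 i)).card := by
      rw [card_erase_of_mem (mem_univ _), card_univ, Fintype.card_fin]
      have := hp i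
      omega
    obtain ⟨c, hc, d, hd, hne⟩ := one_lt_card.1 h2
    exact ⟨c, d, (mem_erase.1 hc).1, (mem_erase.1 hd).1, hne⟩
  choose c d hc hd hcd using hcd
  have hTA : ∀ i, i ∉ T → ¬ Relevant A i := fun i hi hR => hi ((hTdef i).2 (Or.inl hR))
  have hTB : ∀ i, i ∉ T → ¬ Relevant B i := fun i hi hR => hi ((hTdef i).2 (Or.inr hR))
  have cr : ∀ x ∈ A, ∀ y ∈ B, r + (Dv T x0 x ∪ Dv T x0 y).card ≤ T.card := by
    intro x hx y hy
    have e1 := Dv_tv (T := T) (x0 := x0) (c := c) (X := Dv T x0 x) Dv_sub hc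
    have e2 := Dv_tv (T := T) (x0 := x0) (c := d) (X := Dv T x0 y) Dv_sub hd
    have h1 : tv T x0 c (Dv T x0 x) ∈ A := mono_all hA hTA hx e1.le
    have h2 : tv T x0 d (Dv T x0 y) ∈ B := mono_all hB hTB hy e2.le
    have h3 := h.1 _ h1 _ h2
    have h4 := agree_tv (T := T) (X := Dv T x0 x) (Y := Dv T x0 y) Dv_sub Dv_sub hc hd hcd
    omega
  have hrT : r ≤ T.card := by
    obtain ⟨x, hx⟩ := card_pos.1 (h.pos hrn hp).1
    obtain ⟨y, hy⟩ := card_pos.1 (h.pos hrn hp).2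
    have := cr x hx y hy
    omega
  obtain ⟨t, ht⟩ : ∃ t, T.card = r + t := ⟨T.card - r, by omega⟩
  obtain ⟨memA, subA, downA, emA, dualA, relA, eqA⟩ := half h hrn hp (d := d) hA hTA hc t ht
  obtain ⟨memB, subB, downB, emB, dualB, relB, eqB⟩ := half h.symm hrn hp (d := d) hB hTB hc t ht
  have cross : ∀ X ∈ A.image (Dv T x0), ∀ Y ∈ B.image (Dv T x0), (X ∪ Y).card ≤ t := by
    intro X hX Y hY
    obtain ⟨x, hx, rfl⟩ := mem_image.1 hX
    obtain ⟨y, hy, rfl⟩ := mem_image.1 hY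
    have := cr x hx y hy
    omega
  have cross' : ∀ X ∈ B.image (Dv T x0), ∀ Y ∈ A.image (Dv T x0), (X ∪ Y).card ≤ t := by
    intro X hX Y hY
    rw [union_comm]; exact cross Y hY X hX
  have cardA := card_fam hp T x0 _ subA
  have cardB := card_fam hp T x0 _ subB
  rw [← eqA] at cardA
  rw [← eqB] at cardB
  have hcfg : Cfg (fun i => (p i : ℝ) - 1) T t (A.image (Dv T x0)) (B.image (Dv T x0)) := by
    refine ⟨?_, ?_, subA, subB, downA, downB, emA, emB, cross, dualA, ?_, ?_, ?_, ?_⟩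
    · intro i _
      have : (3 : ℝ) ≤ p i := by exact_mod_cast hp i
      show (2 : ℝ) ≤ (p i : ℝ) - 1
      linarith
    · omega
    · intro Y hY hX
      exact dualB Y hY (fun X hX' => by rw [union_comm]; exact hX X hX')
    · intro a ha
      rcases (hTdef a).1 ha with hR | hR
      · exact relA a hR
      · exact rel_transfer subB cross
          (fun Y hY hX => dualB Y hY (fun X hX' => by rw [union_comm]; exact hX X hX')) ha (relB a hR)
    · intro a ha
      rcases (hTdef a).1 ha with hR | hR
      · exact rel_transfer subA cross'
          (fun Y hY hX => dualA Y hY (fun X hX' => by rw [union_comm]; exact hX X hX')) ha (relA a hR)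
      · exact relB a hR
    · intro H hH hHc
      have h1 := h.2 (univ.filter (fun x => Dv T x0 x ∈ H)) (univ.filter (fun x => Dv T x0 x ∈ H)) (by
        intro x hx y hy
        rw [mem_filter] at hx hy
        have h2 := hHc _ hx.2 _ hy.2
        have h3 := agree_ge T x0 x y
        omega)
      have h2 : ((univ.filter (fun x => Dv T x0 x ∈ H)).card : ℝ)
          * ((univ.filter (fun x => Dv T x0 x ∈ H)).card : ℝ) ≤ (A.card : ℝ) * B.card := by
        exact_mod_cast h1
      rw [card_fam hp T x0 H hH, cardA, cardB] at h2
      have h3 : (0 : ℝ) < ∏ i ∈ univ \ T, (p i : ℝ) := by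
        apply prod_pos
        intro i _
        have : 0 < p i := by have := hp i; omega
        exact_mod_cast this
      have h4 : (0 : ℝ) < (∏ i ∈ univ \ T, (p i : ℝ)) ^ 2 := by positivity
      refine le_of_mul_le_mul_left ?_ h4
      linarith
  obtain ⟨⟨k, hk⟩, ⟨l, hl⟩⟩ := hcfg.classify (by omega)
  constructor
  · refine ⟨T, x0, k, ?_⟩
    rw [eqA, hk]
    ext x
    simp only [mem_filter, mem_univ, true_and, mem_lev, hBall]
    have e : Dv T x0 x = T.filter (fun i => x i ≠ x0 i) := by ext i; simp [mem_Dv]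
    rw [← e]
    exact ⟨fun h => h.2, fun h => ⟨Dv_sub, h⟩⟩
  · refine ⟨T, x0, l, ?_⟩
    rw [eqB, hl]
    ext x
    simp only [mem_filter, mem_univ, true_and, mem_lev, hBall]
    have e : Dv T x0 x = T.filter (fun i => x i ≠ x0 i) := by ext i; simp [mem_Dv]
    rw [← e]
    exact ⟨fun h => h.2, fun h => ⟨Dv_sub, h⟩⟩

end glue

open scoped Classical in
/-- Theorem 8, part 2: if `p_i > 2` for all `i` and `(A, B)` is a maximal pair
of `r`-cross-intersecting families in `S_p` with at most `r + 3` relevant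
coordinates, then `A` and `B` are balls. -/
theorem theorem8_part2 {n : ℕ} (r : ℕ) (hr : 1 ≤ r) (hrn : r ≤ n)
    (p : Fin n → ℕ) (hp : ∀ i, 2 < p i)
    (A B : Finset (∀ i, Fin (p i))) (hAB : MaxPair r A B)
    (hrel : (univ.filter (fun i => Relevant A i ∨ Relevant B i)).card ≤ r + 3) :
    IsBall A ∧ IsBall B := by
  exact glue_main hr hrn hp hAB _ (fun i => by simp) hrel
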